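/- arXiv:math/0508146 — 3 statements merged into one kernel-verified Lean document; each statement's English description precedes it below -/
import Mathlib

section
/- Assume cov(ℳ) = 𝔟 = 𝔡. Then there exists a σ-compact subgroup H of the Baer–Specker group ℤ^ℕ and a subgroup G of H such that for every k ∈ ℕ the finite power G^k is Rothberger-bounded (and G is Hurewicz-bounded), but G does not have the Menger property. -/
open Filter Set Topology Pointwise

def MengerBounded (G : Type*) [AddGroup G] [TopologicalSpace G] : Prop :=
  ∀ U : ℕ → Set G, (∀ n, U n ∈ nhds (0 : G)) →
    ∃ F : ℕ → Finset G, ∀ g : G, ∃ n, g ∈ (F n : Set G) + U n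

def ScheepersBounded (G : Type*) [AddGroup G] [TopologicalSpace G] : Prop :=
  ∀ U : ℕ → Set G, (∀ n, U n ∈ nhds (0 : G)) →
    ∃ F : ℕ → Finset G, ∀ E : Finset G, ∃ n, (E : Set G) ⊆ (F n : Set G) + U n

def HurewiczBounded (G : Type*) [AddGroup G] [TopologicalSpace G] : Prop :=
  ∀ U : ℕ → Set G, (∀ n, U n ∈ nhds (0 : G)) →
    ∃ F : ℕ → Finset G, ∀ g : G, ∀ᶠ n in atTop, g ∈ (F n : Set G) + U n

def RothbergerBounded (G : Type*) [AddGroup G] [TopologicalSpace G] : Prop :=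
  ∀ U : ℕ → Set G, (∀ n, U n ∈ nhds (0 : G)) →
    ∃ a : ℕ → G, ∀ g : G, ∃ n, g ∈ ({a n} : Set G) + U n

def HasMenger (X : Type*) [TopologicalSpace X] : Prop :=
  ∀ U : ℕ → Set (Set X), (∀ n, ∀ u ∈ U n, IsOpen u) → (∀ n, ⋃₀ U n = univ) →
    ∃ F : ℕ → Set (Set X), (∀ n, (F n).Finite ∧ F n ⊆ U n) ∧ ⋃ n, ⋃₀ F n = univ

def HasScheepers (X : Type*) [TopologicalSpace X] : Prop :=
  ∀ U : ℕ → Set (Set X), (∀ n, ∀ u ∈ U n, IsOpen u) → (∀ n, ⋃₀ U n = univ) →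
    ∃ F : ℕ → Set (Set X), (∀ n, (F n).Finite ∧ F n ⊆ U n) ∧
      ∀ E : Set X, E.Finite → ∃ n, E ⊆ ⋃₀ F n

def HasHurewicz (X : Type*) [TopologicalSpace X] : Prop :=
  ∀ U : ℕ → Set (Set X), (∀ n, ∀ u ∈ U n, IsOpen u) → (∀ n, ⋃₀ U n = univ) →
    ∃ F : ℕ → Set (Set X), (∀ n, (F n).Finite ∧ F n ⊆ U n) ∧
      ∀ x : X, ∀ᶠ n in atTop, x ∈ ⋃₀ F n

def HasRothberger (X : Type*) [TopologicalSpace X] : Prop :=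
  ∀ U : ℕ → Set (Set X), (∀ n, ∀ u ∈ U n, IsOpen u) → (∀ n, ⋃₀ U n = univ) →
    ∃ u : ℕ → Set X, (∀ n, u n ∈ U n) ∧ ⋃ n, u n = univ

def MengerBddSet (Y : Set (ℕ → ℤ)) : Prop :=
  ∃ f : ℕ → ℕ, ∀ y ∈ Y, ∃ᶠ n in atTop, ∀ i < n, |y i| ≤ (f n : ℤ)

def ScheepersBddSet (Y : Set (ℕ → ℤ)) : Prop :=
  ∃ f : ℕ → ℕ, ∀ F : Finset (ℕ → ℤ), (F : Set (ℕ → ℤ)) ⊆ Y →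
    ∃ᶠ n in atTop, ∀ y ∈ F, ∀ i < n, y i ≤ (f n : ℤ)

def HurewiczBddSet (Y : Set (ℕ → ℤ)) : Prop :=
  ∃ f : ℕ → ℕ, ∀ y ∈ Y, ∀ᶠ n in atTop, |y n| ≤ (f n : ℤ)

def RothbergerBddSet (Y : Set (ℕ → ℤ)) : Prop :=
  ∀ h : ℕ → ℕ, StrictMono h → ∃ φ : (n : ℕ) → Fin (h n) → ℤ,
    ∀ y ∈ Y, ∃ n, ∀ i : Fin (h n), y i.val = φ n i

noncomputable def frakb : Cardinal :=
  sInf {c : Cardinal | ∃ B : Set (ℕ → ℕ),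
    (∀ g : ℕ → ℕ, ∃ f ∈ B, ¬ ∀ᶠ n in atTop, f n ≤ g n) ∧ Cardinal.mk ↥B = c}

noncomputable def frakd : Cardinal :=
  sInf {c : Cardinal | ∃ D : Set (ℕ → ℕ),
    (∀ g : ℕ → ℕ, ∃ f ∈ D, ∀ᶠ n in atTop, g n ≤ f n) ∧ Cardinal.mk ↥D = c}

noncomputable def covMeager : Cardinal :=
  sInf {c : Cardinal | ∃ Y : Set (ℕ → ℕ),
    (¬ ∃ f : ℕ → ℕ, ∀ y ∈ Y, ∃ n, f n = y n) ∧ Cardinal.mk ↥Y = c}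

open Classical in
noncomputable def specDist (x y : ℕ → ℤ) : ℝ :=
  if x = y then 0 else 1 / (((sInf {n | x n ≠ y n} : ℕ) : ℝ) + 1)

def HasSMZ (S : Set (ℕ → ℤ)) : Prop :=
  ∀ ε : ℕ → ℝ, (∀ n, 0 < ε n) →
    ∃ U : ℕ → Set (ℕ → ℤ), S ⊆ ⋃ n, U n ∧
      ∀ n, ∀ x ∈ U n, ∀ y ∈ U n, specDist x y < ε n

def HurewiczBoundedMul (G : Type*) [Group G] [TopologicalSpace G] : Prop :=
  ∀ U : ℕ → Set G, (∀ n, U n ∈ nhds (1 : G)) →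
    ∃ F : ℕ → Finset G, ∀ g : G, ∀ᶠ n in atTop, g ∈ (F n : Set G) * U n

def LeftTotallyBounded {G : Type*} [Group G] [TopologicalSpace G] (B : Set G) : Prop :=
  ∀ U ∈ nhds (1 : G), ∃ F : Finset G, B ⊆ (F : Set G) * U

def TotallyBoundedIn {G : Type*} [Group G] [TopologicalSpace G] (B : Set G) : Prop :=
  ∀ U ∈ nhds (1 : G), ∃ F : Finset G, B ⊆ ((F : Set G) * U) ∩ (U * (F : Set G))

/-- A family of fewer than `frakb` functions is eventually dominated by a single function. -/
lemma exists_eventually_ge_of_lt_frakb {ι : Type} (F : ι → ℕ → ℕ)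
    (hι : Cardinal.mk ι < frakb) : ∃ g : ℕ → ℕ, ∀ i, ∀ᶠ n in atTop, F i n ≤ g n := by
  by_contra! hF
  have hle : frakb ≤ Cardinal.mk (Set.range F) := by
    refine csInf_le' ⟨Set.range F, fun g => ?_, rfl⟩
    obtain ⟨i, hi⟩ := hF g
    exact ⟨F i, ⟨i, rfl⟩, by simpa only [not_eventually, not_le] using hi⟩
  exact hι.not_ge (hle.trans Cardinal.mk_range_le)

lemma aleph0_lt_frakb : Cardinal.aleph0 < frakb := by
  by_contra! hle
  obtain ⟨B, hB, hcard⟩ : frakb ∈ {c : Cardinal | ∃ B : Set (ℕ → ℕ),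
      (∀ g : ℕ → ℕ, ∃ f ∈ B, ¬ ∀ᶠ n in atTop, f n ≤ g n) ∧ Cardinal.mk ↥B = c} := by
    refine csInf_mem ⟨_, univ, fun g => ⟨fun n => g n + 1, mem_univ _, ?_⟩, rfl⟩
    simpa using fun x => ⟨x, le_rfl⟩
  have hcount : B.Countable := by
    rw [← Cardinal.le_aleph0_iff_set_countable, hcard]
    exact hle
  have hne : B.Nonempty := (hB 0).imp fun _ h => h.1
  obtain ⟨e, rfl⟩ := hcount.exists_eq_range hne
  obtain ⟨_, ⟨i, rfl⟩, hi⟩ := hB fun n => (Finset.range (n + 1)).sup fun j => e j n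
  refine hi ?_
  filter_upwards [eventually_ge_atTop i] with n hn
  exact Finset.le_sup (f := fun j => e j n) (Finset.mem_range.2 (by omega))

/-- There is a dominating family of cardinality `frakd`. -/
lemma exists_dominating_mk_eq_frakd : ∃ D : Set (ℕ → ℕ),
    (∀ g : ℕ → ℕ, ∃ f ∈ D, ∀ᶠ n in atTop, g n ≤ f n) ∧ Cardinal.mk ↥D = frakd :=
  csInf_mem (s := {c : Cardinal | ∃ D : Set (ℕ → ℕ),
    (∀ g : ℕ → ℕ, ∃ f ∈ D, ∀ᶠ n in atTop, g n ≤ f n) ∧ Cardinal.mk ↥D = c})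
    ⟨_, univ, fun g => ⟨g, mem_univ _, by simp⟩, rfl⟩

/-- Fewer than `covMeager` functions are all guessed by a single function, infinitely often. -/
lemma exists_frequently_eq_of_lt_covMeager {ι : Type} (F : ι → ℕ → ℕ)
    (hι : Cardinal.mk ι < covMeager) :
    ∃ g : ℕ → ℕ, ∀ i N, ∃ n, N ≤ n ∧ g n = F i n := by
  have key : ∀ N : ℕ, ∃ f : ℕ → ℕ, ∀ i, ∃ m, f m = F i (Nat.pair N m) := by
    intro N
    by_contra! hF
    have hle : covMeager ≤ Cardinal.mk (Set.range fun i m => F i (Nat.pair N m)) := by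
      refine csInf_le' ⟨_, ?_, rfl⟩
      rintro ⟨f, hf⟩
      obtain ⟨i, hi⟩ := hF f
      obtain ⟨m, hm⟩ := hf _ ⟨i, rfl⟩
      exact hi m hm
    exact hι.not_ge (hle.trans Cardinal.mk_range_le)
  choose f hf using key
  refine ⟨fun n => f n.unpair.1 n.unpair.2, fun i N => ?_⟩
  obtain ⟨m, hm⟩ := hf N i
  exact ⟨Nat.pair N m, Nat.left_le_pair N m, by simpa using hm⟩

/-- Fewer than `covMeager` tuples of integer sequences are guessed, up to prescribed lengths,
by a single sequence of tuples. -/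
lemma exists_guess_of_lt_covMeager {ι : Type} {k : ℕ} (S : ι → Fin k → ℕ → ℤ) (L : ℕ → ℕ)
    (hι : Cardinal.mk ι < covMeager) :
    ∃ σ : ℕ → Fin k → ℕ → ℤ, ∀ i N, ∃ j, N ≤ j ∧ ∀ t, ∀ x < L j, σ j t x = S i t x := by
  have henc : ∀ j, ∃ code : (Fin k → Fin (L j) → ℤ) → ℕ, Function.Injective code :=
    fun j => exists_injective_nat _
  choose code hcode using henc
  let r : ∀ j, (Fin k → ℕ → ℤ) → Fin k → Fin (L j) → ℤ := fun j s t x => s t x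
  obtain ⟨g, hg⟩ := exists_frequently_eq_of_lt_covMeager
    (fun i j => code j (r j (S i))) hι
  classical
  refine ⟨fun j => if h : ∃ i, g j = code j (r j (S i)) then S h.choose else 0,
    fun i N => ?_⟩
  obtain ⟨j, hNj, hj⟩ := hg i N
  refine ⟨j, hNj, fun t x hx => ?_⟩
  have h : ∃ i, g j = code j (r j (S i)) := ⟨i, hj⟩
  have heq := hcode j (h.choose_spec.symm.trans hj)
  simp only [dif_pos h]
  exact congrFun (congrFun heq t) ⟨x, hx⟩

lemma finite_setOf_bounded_supported (k j : ℕ) :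
    {q : Fin k → ℕ → ℤ | ∀ t x, |q t x| ≤ j ∧ (j ≤ x → q t x = 0)}.Finite := by
  let r : (Fin k → ℕ → ℤ) → Fin k → Fin j → ℤ := fun q t x => q t x
  refine Set.Finite.of_finite_image (f := r)
    ((Set.finite_Icc (fun _ _ => -(j : ℤ)) (fun _ _ => (j : ℤ))).subset ?_) ?_
  · rintro _ ⟨q, hq, rfl⟩
    exact ⟨fun t x => (abs_le.1 (hq t x).1).1, fun t x => (abs_le.1 (hq t x).1).2⟩
  · intro q hq q' hq' h
    ext t x
    rcases lt_or_ge x j with hx | hx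
    · exact congrFun (congrFun h t) ⟨x, hx⟩
    · rw [(hq t x).2 hx, (hq' t x).2 hx]

lemma Set.Finite.exists_enumeration {T : Type*} [Inhabited T] {s : Set T} (hs : s.Finite) :
    ∃ (q : ℕ → T) (C : ℕ), ∀ x ∈ s, ∃ c ≤ C, q c = x := by
  refine ⟨fun c => hs.toFinset.toList.getD c default, hs.toFinset.toList.length, fun x hx => ?_⟩
  have hx' : x ∈ hs.toFinset.toList := by simpa using hx
  obtain ⟨c, hc, rfl⟩ := List.getElem_of_mem hx'
  exact ⟨c, hc.le, List.getD_eq_getElem _ _ hc⟩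

/-- Each gap of `Y` starting at `x` is longer than `B` predicts. -/
def Sparse (Y : Set ℕ) (B : ℕ → ℕ) : Prop :=
  ∀ x ∈ Y, ∀ x' ∈ Y, x < x' → B x < x'

lemma exists_infinite_sparse (B : ℕ → ℕ) : ∃ Y : Set ℕ, 0 ∈ Y ∧ Y.Infinite ∧ Sparse Y B := by
  let e : ℕ → ℕ := fun n => Nat.rec 0 (fun _ x => max (B x) x + 1) n
  have hsucc : ∀ n, e (n + 1) = max (B (e n)) (e n) + 1 := fun _ => rfl
  have hmono : StrictMono e := strictMono_nat_of_lt_succ fun n => by rw [hsucc]; omega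
  refine ⟨Set.range e, ⟨0, rfl⟩, Set.infinite_range_of_injective hmono.injective, ?_⟩
  rintro _ ⟨i, rfl⟩ _ ⟨i', rfl⟩ hlt
  have := hmono.monotone (Nat.succ_le_of_lt (hmono.lt_iff_lt.1 hlt))
  rw [Nat.succ_eq_add_one, hsucc] at this
  omega

/-- Finitely many sufficiently sparse sets simultaneously miss one of the intervals
`[T^[i] N, T^[i + 1] N)`. -/
lemma exists_common_gap {T : ℕ → ℕ} (hT : Monotone T) (hT' : ∀ n, n < T n)
    (A : Finset (Set ℕ)) (N : ℕ) (hAN : A.card ≤ N)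
    (hA : ∀ Y ∈ A, ∃ B, Sparse Y B ∧ ∀ n ≥ N, T^[n + 1] n ≤ B n) :
    ∃ M, N ≤ M ∧ ∀ Y ∈ A, ∀ x ∈ Y, M ≤ x → T M ≤ x := by
  have hid : id ≤ T := fun n => (hT' n).le
  have hmono : Monotone fun i => T^[i] N := fun i j hij =>
    Function.monotone_iterate_of_id_le hid hij N
  have hone : ∀ Y ∈ A, ∃ w, ∀ i ≤ A.card, i ≠ w →
      ∀ x ∈ Y, T^[i] N ≤ x → T^[i + 1] N ≤ x := by
    intro Y hY
    obtain ⟨B, hYB, hB⟩ := hA Y hY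
    by_contra! hno
    have hlt : ∀ i i' x x', i < i' → i' ≤ A.card → x ∈ Y → x' ∈ Y → T^[i] N ≤ x →
        x < T^[i + 1] N → T^[i'] N ≤ x' → x' < T^[i' + 1] N → False := by
      intro i i' x x' hii hi' hx hx' h1 h2 h3 h4
      have hxx : x < x' := h2.trans_le ((hmono (show i + 1 ≤ i' from hii)).trans h3)
      have hNx : N ≤ x := le_trans (hmono (Nat.zero_le i)) h1
      have h5 : T^[i' + 1] N ≤ T^[x + 1] x :=
        (hmono (show i' + 1 ≤ x + 1 by omega)).trans (hT.iterate (x + 1) hNx)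
      have h6 := hYB x hx x' hx' hxx
      have h7 := hB x hNx
      omega
    obtain ⟨i, hi, -, x, hx, h1, h2⟩ := hno (A.card + 1)
    obtain ⟨i', hi', hne, x', hx', h3, h4⟩ := hno i
    rcases hne.lt_or_gt with h | h
    · exact hlt i' i x' x h hi hx' hx h3 h4 h1 h2
    · exact hlt i i' x x' h hi' hx hx' h1 h2 h3 h4
  choose! w hw using hone
  obtain ⟨i, hi, hiw⟩ : ∃ i ∈ Finset.range (A.card + 1), i ∉ A.image w :=
    Finset.exists_mem_notMem_of_card_lt_card (by
      rw [Finset.card_range]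
      exact Nat.lt_succ_of_le Finset.card_image_le)
  refine ⟨T^[i] N, hmono (Nat.zero_le i), fun Y hY x hx hle => ?_⟩
  rw [← Function.iterate_succ_apply' T]
  refine hw Y hY i (by simpa [Nat.lt_succ_iff] using hi) ?_ x hx hle
  rintro rfl
  exact hiw (Finset.mem_image_of_mem w hY)

/-- A growth rate `V` such that a single sequence `a` of tuples guesses, on the first `h n`
coordinates, every `s + l` where `s` is a tuple from `S` and `l` is a bounded tuple supported
on finitely many sets that are sparse with respect to `V`. -/
def IsGuessingRate (S : Set (ℕ → ℤ)) (h : ℕ → ℕ) (k : ℕ) (V : ℕ → ℕ) : Prop :=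
  ∃ a : ℕ → Fin k → ℕ → ℤ, ∀ s : Fin k → ℕ → ℤ, (∀ t, s t ∈ S) →
    ∀ (l : Fin k → ℕ → ℤ) (A : Finset (Set ℕ)) (M N : ℕ),
      (∀ Y ∈ A, ∃ B, Sparse Y B ∧ ∀ᶠ n in atTop, V n ≤ B n) → (∀ t x, |l t x| ≤ M) →
      (∀ t x, l t x ≠ 0 → ∃ Y ∈ A, x ∈ Y) →
      ∃ n ≥ N, ∀ t, ∀ x < h n, a n t x = s t x + l t x

lemma exists_isGuessingRate (S : Set (ℕ → ℤ)) (h : ℕ → ℕ) (k : ℕ)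
    (hSb : Cardinal.mk S < frakb) (hSc : Cardinal.mk S < covMeager)
    (hc : Cardinal.aleph0 < covMeager) : ∃ V, IsGuessingRate S h k V := by
  choose q C hqC using fun j => (finite_setOf_bounded_supported k j).exists_enumeration
  let L : ℕ → ℕ := fun j => (Finset.range (C j + 1)).sup fun c => h (Nat.pair j c)
  have hpow : Cardinal.mk (Fin k → S) ≤ max (Cardinal.mk S) Cardinal.aleph0 := by
    simpa using Cardinal.power_nat_le_max (c := Cardinal.mk S) (n := k)
  obtain ⟨σ, hσ⟩ := exists_guess_of_lt_covMeager (fun (s : Fin k → S) t => (s t : ℕ → ℤ)) L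
    (hpow.trans_lt (max_lt hSc hc))
  choose J hJ hJσ using hσ
  obtain ⟨E, hE⟩ := exists_eventually_ge_of_lt_frakb J
    (hpow.trans_lt (max_lt hSb aleph0_lt_frakb))
  let T₀ : ℕ → ℕ := fun n => n + 1 + E n + (Finset.range (E n + 1)).sup L
  let T : ℕ → ℕ := fun n => (Finset.range (n + 1)).sup T₀
  have hTmono : Monotone T := fun m n hmn =>
    Finset.sup_mono (Finset.range_mono (by omega))
  have hT₀ : ∀ n, T₀ n ≤ T n := fun n => Finset.le_sup (Finset.self_mem_range_succ n)
  have hT : ∀ n, n < T n := fun n => lt_of_lt_of_le (by simp only [T₀]; omega) (hT₀ n)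
  refine ⟨fun n => T^[n + 1] n, fun n => σ n.unpair.1 + q n.unpair.1 n.unpair.2, ?_⟩
  intro s hs l A M N hA hlM hlA
  choose! B hAB hB using hA
  obtain ⟨N₀, hN₀⟩ := eventually_atTop.1 ((hE fun t => ⟨s t, hs t⟩).and
    (A.eventually_all.2 hB))
  obtain ⟨m, hm, hgap⟩ := exists_common_gap hTmono hT A (N + M + A.card + N₀) (by omega)
    fun Y hY => ⟨B Y, hAB Y hY, fun n hn => (hN₀ n (by omega)).2 Y hY⟩
  set j := J (fun t => ⟨s t, hs t⟩) m with hj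
  have hmj : m ≤ j := hJ _ _
  have hjE : j ≤ E m := (hN₀ m (by omega)).1
  have hLT : L j ≤ T m := by
    refine le_trans ?_ (hT₀ m)
    have := Finset.le_sup (f := L) (Finset.mem_range.2 (Nat.lt_add_one_of_le hjE))
    simp only [T₀]
    omega
  have hl0 : ∀ t x, j ≤ x → x < L j → l t x = 0 := by
    intro t x hx hxL
    by_contra hne
    obtain ⟨Y, hY, hxY⟩ := hlA t x hne
    have := hgap Y hY x hxY (by omega)
    omega
  obtain ⟨c, hc, hqc⟩ := hqC j (fun t x => if x < j then l t x else 0) (by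
    intro t x
    dsimp only
    split_ifs with hx
    · exact ⟨(hlM t x).trans (by exact_mod_cast (by omega)), fun h => by omega⟩
    · simp)
  have hhL : h (Nat.pair j c) ≤ L j :=
    Finset.le_sup (f := fun c => h (Nat.pair j c)) (Finset.mem_range.2 (Nat.lt_succ_of_le hc))
  refine ⟨Nat.pair j c, le_trans (by omega) (Nat.left_le_pair j c), fun t x hx => ?_⟩
  have h1 := hJσ (fun t => ⟨s t, hs t⟩) m t x (hx.trans_le hhL)
  simp only [Nat.unpair_pair, Pi.add_apply, hqc, ← hj] at h1 ⊢
  rw [h1]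
  split_ifs with hxj
  · rfl
  · rw [hl0 t x (by omega) (by omega)]

/-- Transfinite construction: a predicate on `z i` that depends only on the restriction of `z`
to `Iio i` can be satisfied at all `i` simultaneously. -/
lemma exists_forall_of_wellFoundedLT {I D : Type*} [Preorder I] [WellFoundedLT I] [Inhabited D]
    (R : I → (I → D) → D → Prop)
    (hcongr : ∀ i z z' d, (∀ j < i, z j = z' j) → R i z d → R i z' d)
    (hex : ∀ i z, ∃ d, R i z d) : ∃ z : I → D, ∀ i, R i z (z i) := by
  classical
  choose d hd using hex
  let ext : ∀ i : I, (∀ j, j < i → D) → I → D := fun i ih j =>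
    if h : j < i then ih j h else default
  let F : ∀ i : I, (∀ j, j < i → D) → D := fun i ih => d i (ext i ih)
  have hwf : WellFounded (fun a b : I => a < b) := wellFounded_lt
  refine ⟨hwf.fix F, fun i => ?_⟩
  rw [hwf.fix_eq]
  refine hcongr i _ _ _ (fun j hj => ?_) (hd i _)
  simp only [ext, dif_pos hj]

/-- The combinations of the `z j` with `j < i`. -/
def initialSpan {I : Type*} [Preorder I] (z : I → ℕ → ℤ) (i : I) : Set (ℕ → ℤ) :=
  Set.range fun c : Set.Iio i →₀ ℤ => Finsupp.linearCombination ℤ (fun j : Set.Iio i => z j) c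

lemma initialSpan_congr {I : Type*} [Preorder I] {z z' : I → ℕ → ℤ} {i : I}
    (h : ∀ j < i, z j = z' j) : initialSpan z i = initialSpan z' i := by
  have : (fun j : Set.Iio i => z j) = fun j : Set.Iio i => z' j := funext fun j => h j j.2
  simp only [initialSpan, this]

lemma linearCombination_mem_initialSpan {I : Type*} [Preorder I] (z : I → ℕ → ℤ) (i : I)
    (c : I →₀ ℤ) (hc : ∀ j ∈ c.support, j < i) :
    Finsupp.linearCombination ℤ z c ∈ initialSpan z i := by
  have hc' : c ∈ Finsupp.supported ℤ ℤ (Set.Iio i) := fun j hj => hc j hj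
  have : Finsupp.linearCombination ℤ z c ∈ Submodule.span ℤ (z '' Set.Iio i) := by
    rw [Finsupp.span_image_eq_map_linearCombination]
    exact Submodule.mem_map_of_mem hc'
  rw [Set.image_eq_range, ← Finsupp.range_linearCombination] at this
  obtain ⟨d, hd⟩ := this
  exact ⟨d, hd⟩

lemma mk_initialSpan_le {I : Type} [Preorder I] (z : I → ℕ → ℤ) (i : I) :
    Cardinal.mk (initialSpan z i) ≤ max (Cardinal.mk (Set.Iio i)) Cardinal.aleph0 := by
  refine Cardinal.mk_range_le.trans ?_
  rcases finite_or_infinite (Set.Iio i) with hfin | hinf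
  · exact Cardinal.mk_le_aleph0.trans (le_max_right _ _)
  · simp

/-- Transfinite construction of sparse sets whose growth rates dominate all functions attached
to the earlier stages. -/
lemma exists_sparse_family {I : Type} [LinearOrder I] [WellFoundedLT I]
    (hI : ∀ i : I, Cardinal.mk (Set.Iio i) < frakb) (f : I → ℕ → ℕ)
    (V : (ℕ → ℕ) → ℕ → Set (ℕ → ℤ) → ℕ → ℕ) :
    ∃ (z : I → ℕ → ℤ) (Y : I → Set ℕ) (B : I → ℕ → ℕ), ∀ i,
      z i = (Y i).indicator 1 ∧ 0 ∈ Y i ∧ (Y i).Infinite ∧ Sparse (Y i) (B i) ∧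
      (∀ n, f i n ≤ B i n) ∧
      (∀ j ≤ i, ∀ k, ∀ᶠ n in atTop, V (f j) k (initialSpan z j) n ≤ B i n) ∧
      (∀ s ∈ initialSpan z i, (∃ᶠ n in atTop, s n ≠ 0) →
        ∀ᶠ n in atTop, ∃ x, n < x ∧ x ≤ B i n ∧ s x ≠ 0) := by
  have hnext : ∀ s : ℕ → ℤ, ∃ b : ℕ → ℕ, (∃ᶠ n in atTop, s n ≠ 0) →
      ∀ n, n < b n ∧ s (b n) ≠ 0 := by
    intro s
    by_cases hs : ∃ᶠ n in atTop, s n ≠ 0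
    · choose b hb using frequently_atTop'.1 hs
      exact ⟨b, fun _ => hb⟩
    · exact ⟨0, fun h => absurd h hs⟩
  choose next hnext using hnext
  obtain ⟨z, hz⟩ := exists_forall_of_wellFoundedLT
    (fun (i : I) (z : I → ℕ → ℤ) (y : ℕ → ℤ) => ∃ (Y : Set ℕ) (B : ℕ → ℕ),
      y = Y.indicator 1 ∧ 0 ∈ Y ∧ Y.Infinite ∧ Sparse Y B ∧ (∀ n, f i n ≤ B n) ∧
      (∀ j ≤ i, ∀ k, ∀ᶠ n in atTop, V (f j) k (initialSpan z j) n ≤ B n) ∧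
      (∀ s ∈ initialSpan z i, ∀ᶠ n in atTop, next s n ≤ B n))
    (by
      rintro i z z' y hzz' ⟨Y, B, h1, h2, h3, h4, h5, h6, h7⟩
      refine ⟨Y, B, h1, h2, h3, h4, h5, fun j hj => ?_, ?_⟩
      · rw [← initialSpan_congr fun j' hj' => hzz' j' (hj'.trans_le hj)]
        exact h6 j hj
      · rwa [← initialSpan_congr hzz'])
    (by
      intro i z
      have hIic : Cardinal.mk (Set.Iic i) < frakb := by
        rw [← Set.Iio_insert]
        exact Cardinal.mk_insert_le.trans_lt (Cardinal.add_lt_of_lt aleph0_lt_frakb.le (hI i)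
          (Cardinal.one_lt_aleph0.trans aleph0_lt_frakb))
      have hcard : Cardinal.mk ((Set.Iic i × ℕ) ⊕ initialSpan z i) < frakb := by
        rw [Cardinal.mk_sum, Cardinal.mk_prod]
        simp only [Cardinal.lift_id, Cardinal.mk_nat]
        exact Cardinal.add_lt_of_lt aleph0_lt_frakb.le
          (Cardinal.mul_lt_of_lt aleph0_lt_frakb.le hIic aleph0_lt_frakb)
          ((mk_initialSpan_le z i).trans_lt (max_lt (hI i) aleph0_lt_frakb))
      obtain ⟨g, hg⟩ := exists_eventually_ge_of_lt_frakb (Sum.elim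
        (fun p : Set.Iic i × ℕ => V (f p.1) p.2 (initialSpan z p.1))
        (fun s : initialSpan z i => next s)) hcard
      obtain ⟨Y, h0, hY, hYB⟩ := exists_infinite_sparse (fun n => max (g n) (f i n))
      refine ⟨_, Y, _, rfl, h0, hY, hYB, fun n => le_max_right _ _, fun j hj k => ?_,
        fun s hs => ?_⟩
      · exact (hg (Sum.inl (⟨j, hj⟩, k))).mono fun n hn => le_max_of_le_left hn
      · exact (hg (Sum.inr ⟨s, hs⟩)).mono fun n hn => le_max_of_le_left hn)
  choose Y B hz using hz
  refine ⟨z, Y, B, fun i => ?_⟩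
  obtain ⟨h1, h2, h3, h4, h5, h6, h7⟩ := hz i
  refine ⟨h1, h2, h3, h4, h5, h6, fun s hs hinf => ?_⟩
  filter_upwards [h7 s hs] with n hn
  exact ⟨next s n, (hnext s hinf n).1, hn, (hnext s hinf n).2⟩

lemma frequently_add_smul_indicator_ne_zero {s : ℕ → ℤ} {c : ℤ} (hc : c ≠ 0) {Y : Set ℕ}
    {B : ℕ → ℕ} (hY : Y.Infinite) (hYB : Sparse Y B)
    (hs : (∃ᶠ n in atTop, s n ≠ 0) → ∀ᶠ n in atTop, ∃ x, n < x ∧ x ≤ B n ∧ s x ≠ 0) :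
    ∃ᶠ n in atTop, (s + c • Y.indicator (1 : ℕ → ℤ)) n ≠ 0 := by
  have hY' : ∃ᶠ n in atTop, n ∈ Y := Nat.frequently_atTop_iff_infinite.2 hY
  by_cases hinf : ∃ᶠ n in atTop, s n ≠ 0
  · rw [frequently_atTop]
    intro N
    obtain ⟨n, ⟨hn, x, hnx, hxB, hx⟩, hNn⟩ :=
      ((hY'.and_eventually (hs hinf)).and_eventually (eventually_ge_atTop N)).exists
    refine ⟨x, by omega, ?_⟩
    have hxY : x ∉ Y := fun hxY => (hYB n hn x hxY hnx).not_ge hxB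
    simpa [hxY] using hx
  · have hfin : ∀ᶠ n in atTop, s n = 0 := by simpa using hinf
    refine (hY'.and_eventually hfin).mono fun n hn => ?_
    simp [hn.1, hn.2, hc]

lemma exists_forall_mem_of_mem_nhds_zero {G : AddSubgroup (ℕ → ℤ)} {U : Set G}
    (hU : U ∈ nhds (0 : G)) :
    ∃ h : ℕ, ∀ g : G, (∀ x < h, (g : ℕ → ℤ) x = 0) → g ∈ U := by
  by_contra! hno
  choose u hu huU using hno
  have hlim : Tendsto u atTop (nhds 0) := by
    rw [tendsto_subtype_rng, tendsto_pi_nhds]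
    intro x
    refine tendsto_const_nhds.congr' ?_
    filter_upwards [eventually_gt_atTop x] with n hn
    exact (hu n x hn).symm
  obtain ⟨n, hn⟩ := (hlim.eventually hU).exists
  exact huU n hn

lemma exists_forall_mem_of_mem_nhds_zero_pi {G : AddSubgroup (ℕ → ℤ)} {k : ℕ}
    {U : Set (Fin k → G)} (hU : U ∈ nhds (0 : Fin k → G)) :
    ∃ h : ℕ, ∀ g : Fin k → G, (∀ t, ∀ x < h, (g t : ℕ → ℤ) x = 0) → g ∈ U := by
  rw [nhds_pi, Filter.mem_pi] at hU
  obtain ⟨J, -, W, hW, hWU⟩ := hU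
  choose h hh using fun t => exists_forall_mem_of_mem_nhds_zero (hW t)
  refine ⟨Finset.univ.sup h, fun g hg => hWU fun t _ => hh t (g t) fun x hx => hg t x ?_⟩
  exact hx.trans_le (Finset.le_sup (Finset.mem_univ t))

lemma rothbergerBounded_pi_of_forall_exists {G : AddSubgroup (ℕ → ℤ)} {k : ℕ}
    (hG : ∀ h : ℕ → ℕ, ∃ a : ℕ → Fin k → ℕ → ℤ, ∀ g : Fin k → G, ∃ n, ∀ t, ∀ x < h n,
      a n t x = (g t : ℕ → ℤ) x) : RothbergerBounded (Fin k → G) := by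
  intro U hU
  choose h hh using fun n => exists_forall_mem_of_mem_nhds_zero_pi (hU n)
  obtain ⟨a, ha⟩ := hG h
  have hb : ∀ n, ∃ b : Fin k → G, (∃ g : Fin k → G, ∀ t, ∀ x < h n,
      a n t x = (g t : ℕ → ℤ) x) → ∀ t, ∀ x < h n, a n t x = (b t : ℕ → ℤ) x := by
    intro n
    by_cases hex : ∃ g : Fin k → G, ∀ t, ∀ x < h n, a n t x = (g t : ℕ → ℤ) x
    · exact ⟨hex.choose, fun _ => hex.choose_spec⟩
    · exact ⟨0, fun h => absurd h hex⟩
  choose b hb using hb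
  refine ⟨b, fun g => ?_⟩
  obtain ⟨n, hn⟩ := ha g
  refine ⟨n, b n, rfl, g - b n, hh n _ fun t x hx => ?_, add_sub_cancel _ _⟩
  simp [← hb n ⟨g, hn⟩ t x hx, hn t x hx]

lemma hurewiczBounded_of_forall_bounded {G : AddSubgroup (ℕ → ℤ)}
    (hG : ∀ g ∈ G, ∃ M : ℕ, ∀ x, |g x| ≤ M) : HurewiczBounded G := by
  intro U hU
  choose h hh using fun n => exists_forall_mem_of_mem_nhds_zero (hU n)
  have hF : ∀ n : ℕ, ∃ F : Finset G, ∀ g : G, (∀ x, |(g : ℕ → ℤ) x| ≤ n) →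
      ∃ a ∈ F, ∀ x < h n, (a : ℕ → ℤ) x = (g : ℕ → ℤ) x := by
    intro n
    let r : G → Fin (h n) → ℤ := fun g x => (g : ℕ → ℤ) x
    have hfin : (r '' {g | ∀ x, |(g : ℕ → ℤ) x| ≤ n}).Finite := by
      refine (Set.finite_Icc (fun _ => -(n : ℤ)) (fun _ => (n : ℤ))).subset ?_
      rintro _ ⟨g, hg, rfl⟩
      exact ⟨fun x => (abs_le.1 (hg x)).1, fun x => (abs_le.1 (hg x)).2⟩
    obtain ⟨P, -, hPfin, hP⟩ := Set.exists_subset_image_finite_and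
      (p := (· = r '' {g | ∀ x, |(g : ℕ → ℤ) x| ≤ n})).1 ⟨_, subset_rfl, hfin, rfl⟩
    refine ⟨hPfin.toFinset, fun g hg => ?_⟩
    obtain ⟨a, ha, har⟩ : r g ∈ r '' P := hP ▸ Set.mem_image_of_mem r hg
    exact ⟨a, by simpa using ha, fun x hx => congrFun har ⟨x, hx⟩⟩
  choose F hF using hF
  refine ⟨F, fun g => ?_⟩
  obtain ⟨M, hM⟩ := hG g g.2
  filter_upwards [eventually_ge_atTop M] with n hn
  obtain ⟨a, ha, hag⟩ := hF n g fun x => (hM x).trans (by exact_mod_cast hn)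
  refine ⟨a, ha, g - a, hh n _ fun x hx => ?_, add_sub_cancel _ _⟩
  simp [hag x hx]

lemma Set.Finite.exists_forall_subset_of_subset_range {X : Type*} {W : ℕ → Set X}
    (hW : Monotone W) {F : Set (Set X)} (hF : F.Finite) (hFW : F ⊆ Set.range W) :
    ∃ m, ⋃₀ F ⊆ W m := by
  choose! i hi using hFW
  obtain ⟨m, hm⟩ := (hF.image i).bddAbove
  refine ⟨m, Set.sUnion_subset fun u hu => ?_⟩
  rw [← hi hu]
  exact hW (hm (Set.mem_image_of_mem i hu))

lemma not_hasMenger_of_dominating {G : AddSubgroup (ℕ → ℤ)}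
    (hinf : ∀ g ∈ G, g 0 = 1 → ∃ᶠ n in atTop, g n ≠ 0)
    (hdom : ∀ m : ℕ → ℕ, ∃ (Y : Set ℕ) (B : ℕ → ℕ), Y.indicator 1 ∈ G ∧ 0 ∈ Y ∧ Sparse Y B ∧
      ∀ᶠ n in atTop, m n ≤ B n) : ¬ HasMenger G := by
  intro hM
  let W : ℕ → ℕ → Set G := fun n m => {g | (g : ℕ → ℤ) 0 ≠ 1 ∨
    ∃ x x', n ≤ x ∧ x < x' ∧ x' ≤ m ∧ (g : ℕ → ℤ) x ≠ 0 ∧ (g : ℕ → ℤ) x' ≠ 0}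
  have hWmono : ∀ n, Monotone (W n) := by
    rintro n m m' hm g (h | ⟨x, x', h1, h2, h3, h4⟩)
    · exact Or.inl h
    · exact Or.inr ⟨x, x', h1, h2, h3.trans hm, h4⟩
  have hWopen : ∀ n m, IsOpen (W n m) := by
    intro n m
    rw [isOpen_iff_eventually]
    intro g hg
    have hev : ∀ x, ∀ᶠ g' : G in nhds g, (g' : ℕ → ℤ) x = (g : ℕ → ℤ) x := fun x =>
      (((continuous_apply x).comp continuous_subtype_val).tendsto g).eventually
        (isOpen_discrete {(g : ℕ → ℤ) x} |>.mem_nhds rfl)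
    rcases hg with h | ⟨x, x', h1, h2, h3, h4, h5⟩
    · filter_upwards [hev 0] with g' hg'
      exact Or.inl (by rwa [hg'])
    · filter_upwards [hev x, hev x'] with g' hx hx'
      exact Or.inr ⟨x, x', h1, h2, h3, by rwa [hx], by rwa [hx']⟩
  have hWcover : ∀ n, ⋃₀ Set.range (W n) = univ := by
    intro n
    rw [Set.sUnion_range, Set.iUnion_eq_univ_iff]
    intro g
    by_cases h : (g : ℕ → ℤ) 0 = 1
    · have hg := frequently_atTop.1 (hinf g g.2 h)
      obtain ⟨x, hx, hgx⟩ := hg n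
      obtain ⟨x', hx', hgx'⟩ := hg (x + 1)
      exact ⟨x', Or.inr ⟨x, x', hx, hx', le_rfl, hgx, hgx'⟩⟩
    · exact ⟨0, Or.inl h⟩
  have hsel : ∀ N, ∃ m : ℕ → ℕ, ∀ g, ∃ n, g ∈ W (N + n) (m n) := by
    intro N
    obtain ⟨F, hF, hFcover⟩ := hM (fun n => Set.range (W (N + n)))
      (by rintro n _ ⟨m, rfl⟩; exact hWopen _ _) (fun n => hWcover _)
    choose m hm using fun n =>
      (hF n).1.exists_forall_subset_of_subset_range (hWmono (N + n)) (hF n).2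
    refine ⟨m, fun g => ?_⟩
    obtain ⟨n, hn⟩ := Set.mem_iUnion.1 (hFcover.symm ▸ mem_univ g)
    exact ⟨n, hm n hn⟩
  choose m hm using hsel
  obtain ⟨Y, B, hYG, h0, hYB, hB⟩ := hdom fun x => (Finset.range (x + 1)).sup fun N =>
    (Finset.range (x + 1)).sup fun n => m N n
  obtain ⟨N, hN⟩ := eventually_atTop.1 hB
  obtain ⟨n, h | ⟨x, x', h1, h2, h3, h4, h5⟩⟩ := hm N ⟨_, hYG⟩
  · exact h (by simp [h0])
  · have hx : x ∈ Y := Set.mem_of_indicator_ne_zero h4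
    have hx' : x' ∈ Y := Set.mem_of_indicator_ne_zero h5
    have h6 := hYB x hx x' hx' h2
    have h7 := hN x (by omega)
    have h8 : m N n ≤ (Finset.range (x + 1)).sup fun n => m N n :=
      Finset.le_sup (Finset.mem_range.2 (by omega))
    have h9 := Finset.le_sup (f := fun N => (Finset.range (x + 1)).sup fun n => m N n)
      (Finset.mem_range.2 (show N < x + 1 by omega))
    omega

/-- The subgroup of bounded integer sequences. -/
def boundedSequences : AddSubgroup (ℕ → ℤ) where
  carrier := {g | ∃ M : ℕ, ∀ x, |g x| ≤ M}
  zero_mem' := ⟨0, by simp⟩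
  add_mem' := by
    rintro g g' ⟨M, hM⟩ ⟨M', hM'⟩
    refine ⟨M + M', fun x => (abs_add_le _ _).trans ?_⟩
    push_cast
    exact add_le_add (hM x) (hM' x)
  neg_mem' := by
    rintro g ⟨M, hM⟩
    exact ⟨M, by simpa using hM⟩

lemma isSigmaCompact_boundedSequences : IsSigmaCompact (boundedSequences : Set (ℕ → ℤ)) := by
  have : (boundedSequences : Set (ℕ → ℤ)) =
      ⋃ M : ℕ, Set.pi univ fun _ => Set.Icc (-(M : ℤ)) M := by
    ext g
    simp only [boundedSequences, AddSubgroup.coe_set_mk, Set.mem_iUnion, Set.mem_univ_pi,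
      Set.mem_Icc, abs_le]
    rfl
  rw [this]
  exact isSigmaCompact_iUnion_of_isCompact _ fun M =>
    isCompact_univ_pi fun _ => isCompact_Icc

lemma linearCombination_eq_sum_apply {I : Type*} (z : I → ℕ → ℤ) (c : I →₀ ℤ) (x : ℕ) :
    Finsupp.linearCombination ℤ z c x = ∑ i ∈ c.support, c i * z i x := by
  simp [Finsupp.linearCombination_apply, Finsupp.sum, Finset.sum_apply]

theorem stmt_16 (hcov : covMeager = frakb) (hbd : frakb = frakd) :
    ∃ H : AddSubgroup (ℕ → ℤ), IsSigmaCompact (H : Set (ℕ → ℤ)) ∧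
      ∃ G : AddSubgroup (ℕ → ℤ), G ≤ H ∧
        (∀ k : ℕ, RothbergerBounded (Fin k → ↥G)) ∧
        HurewiczBounded ↥G ∧ ¬ HasMenger ↥G := by
  classical
  obtain ⟨D, hD, hDcard⟩ := exists_dominating_mk_eq_frakd
  let I := frakb.ord.ToType
  have hI : ∀ i : I, Cardinal.mk (Set.Iio i) < frakb := fun i => by
    simpa [I] using Cardinal.mk_Iio_lt i (by simp [I])
  obtain ⟨e⟩ : Nonempty (I ≃ D) := Cardinal.eq.1 (by simp [I, hDcard, hbd])
  have hV : ∀ (h : ℕ → ℕ) (k : ℕ) (S : Set (ℕ → ℤ)), ∃ V : ℕ → ℕ,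
      Cardinal.mk S < frakb → IsGuessingRate S h k V := by
    intro h k S
    by_cases hS : Cardinal.mk S < frakb
    · obtain ⟨V, hV⟩ := exists_isGuessingRate S h k hS (hcov ▸ hS) (hcov ▸ aleph0_lt_frakb)
      exact ⟨V, fun _ => hV⟩
    · exact ⟨0, fun h => absurd h hS⟩
  choose V hV using hV
  obtain ⟨z, Y, B, hz⟩ := exists_sparse_family hI (fun i => (e i : ℕ → ℕ)) V
  have hdom : ∀ g : ℕ → ℕ, ∃ i, ∀ᶠ n in atTop, g n ≤ (e i : ℕ → ℕ) n := by
    intro g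
    obtain ⟨f, hf, hgf⟩ := hD g
    exact ⟨e.symm ⟨f, hf⟩, by simpa using hgf⟩
  let G : AddSubgroup (ℕ → ℤ) := (LinearMap.range (Finsupp.linearCombination ℤ z)).toAddSubgroup
  have hzH : ∀ i, z i ∈ boundedSequences := fun i => ⟨1, fun x => by
    rw [(hz i).1]
    by_cases hx : x ∈ Y i <;> simp [hx]⟩
  have hGH : G ≤ boundedSequences := by
    rintro _ ⟨c, rfl⟩
    rw [Finsupp.linearCombination_apply]
    exact AddSubgroup.sum_mem _ fun i _ => AddSubgroup.zsmul_mem _ (hzH i) _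
  refine ⟨boundedSequences, isSigmaCompact_boundedSequences, G, hGH, fun k => ?_,
    hurewiczBounded_of_forall_bounded hGH, not_hasMenger_of_dominating ?_ ?_⟩
  · refine rothbergerBounded_pi_of_forall_exists fun h => ?_
    obtain ⟨i, hi⟩ := hdom h
    obtain ⟨N, hN⟩ := eventually_atTop.1 hi
    obtain ⟨a, ha⟩ := hV (e i) k (initialSpan z i)
      ((mk_initialSpan_le z i).trans_lt (max_lt (hI i) aleph0_lt_frakb))
    refine ⟨a, fun g => ?_⟩
    choose c hc using fun t => (g t).2
    have hlG : ∀ t, ∃ M : ℕ, ∀ x,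
        |Finsupp.linearCombination ℤ z ((c t).filter fun j => ¬ j < i) x| ≤ M :=
      fun t => hGH ⟨_, rfl⟩
    choose M hM using hlG
    obtain ⟨n, hn, han⟩ := ha
      (fun t => Finsupp.linearCombination ℤ z ((c t).filter fun j => j < i))
      (fun t => linearCombination_mem_initialSpan z i _ fun j hj => by
        simp only [Finsupp.support_filter, Finset.mem_filter] at hj
        exact hj.2)
      (fun t => Finsupp.linearCombination ℤ z ((c t).filter fun j => ¬ j < i))
      ((Finset.univ.biUnion fun t => ((c t).filter fun j => ¬ j < i).support).image Y)
      (Finset.univ.sup M) N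
      (by
        intro Y' hY'
        simp only [Finset.mem_image, Finset.mem_biUnion, Finset.mem_univ, true_and,
          Finsupp.support_filter, Finset.mem_filter, not_lt] at hY'
        obtain ⟨j, ⟨t, -, hij⟩, rfl⟩ := hY'
        exact ⟨B j, (hz j).2.2.2.1, (hz j).2.2.2.2.2.1 i hij k⟩)
      (fun t x => (hM t x).trans (by exact_mod_cast Finset.le_sup (Finset.mem_univ t)))
      (by
        intro t x hx
        rw [linearCombination_eq_sum_apply] at hx
        obtain ⟨j, hj, hjx⟩ := Finset.exists_ne_zero_of_sum_ne_zero hx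
        refine ⟨Y j, Finset.mem_image_of_mem Y (Finset.mem_biUnion.2 ⟨t, Finset.mem_univ t, hj⟩),
          ?_⟩
        have := right_ne_zero_of_mul hjx
        rw [(hz j).1] at this
        exact Set.mem_of_indicator_ne_zero this)
    refine ⟨n, fun t x hx => ?_⟩
    rw [han t x (hx.trans_le (hN n hn)), ← hc t, ← Pi.add_apply, ← map_add,
      Finsupp.filter_add_filter_not]
  · rintro _ ⟨c, rfl⟩ h1
    have hne : c.support.Nonempty := by
      rw [Finsupp.support_nonempty_iff]
      rintro rfl
      simp at h1
    set i := c.support.max' hne with hi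
    have hci : c i ≠ 0 := Finsupp.mem_support_iff.1 (c.support.max'_mem hne)
    have hmem : Finsupp.linearCombination ℤ z (c.erase i) ∈ initialSpan z i :=
      linearCombination_mem_initialSpan z i _ fun j hj => by
        rw [Finsupp.support_erase, Finset.mem_erase] at hj
        exact lt_of_le_of_ne (c.support.le_max' j hj.2) hj.1
    have hsum : Finsupp.linearCombination ℤ z c =
        Finsupp.linearCombination ℤ z (c.erase i) + c i • (Y i).indicator (1 : ℕ → ℤ) := by
      conv_lhs => rw [← Finsupp.erase_add_single i c]
      rw [map_add, Finsupp.linearCombination_single, (hz i).1]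
    rw [hsum]
    exact frequently_add_smul_indicator_ne_zero hci (hz i).2.2.1 (hz i).2.2.2.1
      ((hz i).2.2.2.2.2.2 _ hmem)
  · intro m
    obtain ⟨i, hi⟩ := hdom m
    refine ⟨Y i, B i, ⟨Finsupp.single i 1, ?_⟩, (hz i).2.1, (hz i).2.2.2.1,
      hi.mono fun n hn => hn.trans ((hz i).2.2.2.2.1 n)⟩
    simp [(hz i).1]
end

section
/- There exists a subgroup G of the Baer–Specker group ℤ^ℕ such that G is Hurewicz-bounded and G has the Menger property, but G does not have the Hurewicz property and G is not Rothberger-bounded. -/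
open Filter Set Topology Pointwise

/-- Every `ι`-indexed family of functions is bounded modulo finite sets. -/
def FamilyBounded (ι : Type*) : Prop :=
  ∀ φ : ι → ℕ → ℕ, ∃ f : ℕ → ℕ, ∀ i, ∀ᶠ n in atTop, φ i n ≤ f n

theorem FamilyBounded.of_countable (ι : Type*) [Countable ι] : FamilyBounded ι := by
  intro φ
  rcases isEmpty_or_nonempty ι with h | h
  · exact ⟨0, fun i => isEmptyElim i⟩
  · obtain ⟨r, hr⟩ := exists_surjective_nat ι
    refine ⟨fun n => (Finset.range (n + 1)).sup fun j => φ (r j) n, fun i => ?_⟩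
    obtain ⟨j, rfl⟩ := hr i
    filter_upwards [eventually_ge_atTop j] with n hn
    exact Finset.le_sup (f := fun j => φ (r j) n) (Finset.mem_range.2 (by omega))

theorem FamilyBounded.of_injective {ι κ : Type*} (hκ : FamilyBounded κ) {e : ι → κ}
    (he : Function.Injective e) : FamilyBounded ι := by
  intro φ
  obtain ⟨f, hf⟩ := hκ (Function.extend e φ 0)
  exact ⟨f, fun i => by simpa [he.extend_apply] using hf (e i)⟩

theorem not_familyBounded_baire : ¬ FamilyBounded (ℕ → ℕ) := by
  intro h
  obtain ⟨f, hf⟩ := h id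
  obtain ⟨n, hn⟩ := (hf fun n => f n + 1).exists
  simp at hn

/-- An unbounded family of least cardinality. -/
theorem exists_minimal_unbounded :
    ∃ B : Type, ¬ FamilyBounded B ∧
      ∀ ι : Type, Cardinal.mk ι < Cardinal.mk B → FamilyBounded ι := by
  let S : Set Cardinal.{0} := {c | ∃ ι : Type, ¬ FamilyBounded ι ∧ Cardinal.mk ι = c}
  have hS : S.Nonempty := ⟨_, _, not_familyBounded_baire, rfl⟩
  obtain ⟨B, hB, hc⟩ := csInf_mem hS
  refine ⟨B, hB, fun ι hι => ?_⟩
  by_contra h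
  exact absurd (csInf_le' (s := S) ⟨ι, h, rfl⟩) (not_le.2 (hc ▸ hι))

section Covers

variable {Y : Type*} [TopologicalSpace Y]

theorem HasMenger.of_monotone_covers [SecondCountableTopology Y] {G : Set Y} (hne : G.Nonempty)
    (h : ∀ W : ℕ → ℕ → Set Y, (∀ n m, IsOpen (W n m)) → (∀ n, Monotone (W n)) →
      (∀ n, G ⊆ ⋃ m, W n m) → ∃ f : ℕ → ℕ, ∀ x ∈ G, ∃ n, x ∈ W n (f n)) :
    HasMenger G := by
  intro U hUo hUc
  have hV : ∀ n, ∃ V : ℕ → Set G, (∀ m, V m ∈ U n) ∧ ⋃ m, V m = univ := by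
    intro n
    obtain ⟨T, hTc, hTU, hT⟩ := TopologicalSpace.isOpen_sUnion_countable (U n) (hUo n)
    rw [hUc n] at hT
    have hTne : T.Nonempty := by
      obtain ⟨x, hx⟩ := hne
      have : (⟨x, hx⟩ : G) ∈ ⋃₀ T := hT ▸ mem_univ _
      obtain ⟨t, ht, -⟩ := this
      exact ⟨t, ht⟩
    obtain ⟨V, rfl⟩ := hTc.exists_eq_range hTne
    exact ⟨V, fun m => hTU (mem_range_self m), by rw [← hT, sUnion_range]⟩
  choose V hVU hVc using hV
  choose O hOo hOV using fun n m => isOpen_induced_iff.1 (hUo n _ (hVU n m))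
  obtain ⟨f, hf⟩ := h (fun n m => ⋃ j ≤ m, O n j)
    (fun n m => isOpen_biUnion fun j _ => hOo n j)
    (fun n a b hab => biUnion_subset_biUnion_left fun j hj => le_trans hj hab)
    (fun n x hx => by
      have : (⟨x, hx⟩ : G) ∈ ⋃ m, V n m := hVc n ▸ mem_univ _
      obtain ⟨m, hm⟩ := mem_iUnion.1 this
      rw [← hOV] at hm
      exact mem_iUnion.2 ⟨m, mem_iUnion₂.2 ⟨m, le_rfl, hm⟩⟩)
  refine ⟨fun n => V n '' Iic (f n), fun n => ⟨(finite_Iic _).image _, ?_⟩, ?_⟩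
  · rintro _ ⟨m, -, rfl⟩
    exact hVU n m
  · refine eq_univ_of_forall fun x => ?_
    obtain ⟨n, hn⟩ := hf x x.2
    obtain ⟨j, hj, hx⟩ := mem_iUnion₂.1 hn
    refine mem_iUnion.2 ⟨n, V n j, ⟨j, hj, rfl⟩, ?_⟩
    rw [← hOV]
    exact hx

theorem HasHurewicz.exists_bound (hY : HasHurewicz Y) (W : ℕ → ℕ → Set Y)
    (hWo : ∀ n m, IsOpen (W n m)) (hWm : ∀ n, Monotone (W n)) (hWc : ∀ n, ⋃ m, W n m = univ) :
    ∃ f : ℕ → ℕ, ∀ x, ∀ᶠ n in atTop, x ∈ W n (f n) := by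
  obtain ⟨F, hF, hx⟩ := hY (fun n => range (W n))
    (by rintro n _ ⟨m, rfl⟩; exact hWo n m) (fun n => by rw [sUnion_range, hWc n])
  have : ∀ n, ∃ m, ⋃₀ F n ⊆ W n m := by
    intro n
    choose! g hg using (hF n).2
    obtain ⟨m, hm⟩ := ((hF n).1.image g).bddAbove
    refine ⟨m, sUnion_subset fun u hu => ?_⟩
    rw [← hg hu]
    exact hWm n (hm (mem_image_of_mem g hu))
  choose f hf using this
  exact ⟨f, fun x => (hx x).mono fun n hn => hf n hn⟩

theorem IsCompact.subset_of_monotone_cover {C : Set Y} (hC : IsCompact C) {W : ℕ → Set Y}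
    (hWo : ∀ m, IsOpen (W m)) (hWm : Monotone W) (hCW : C ⊆ ⋃ m, W m) : ∃ m, C ⊆ W m :=
  hC.elim_directed_cover W hWo hCW hWm.directed_le

end Covers

/-- An open neighbourhood of a compact set of sequences contains every sequence having a
sufficiently long common initial segment with a member of the compact set. -/
theorem IsCompact.exists_agree_subset {C O : Set (ℕ → ℤ)} (hC : IsCompact C) (hO : IsOpen O)
    (hCO : C ⊆ O) : ∃ L, ∀ z ∈ C, ∀ w : ℕ → ℤ, (∀ i < L, w i = z i) → w ∈ O := by
  let P : ℕ → Set (ℕ → ℤ) := fun L => {z | PiNat.cylinder z L ⊆ O}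
  have hPo : ∀ L, IsOpen (P L) := by
    intro L
    refine isOpen_iff_mem_nhds.2 fun z hz => ?_
    refine mem_of_superset ((PiNat.isOpen_cylinder _ z L).mem_nhds (PiNat.self_mem_cylinder z L)) ?_
    intro w hw
    have := PiNat.mem_cylinder_iff_eq.1 hw
    simpa [P, this] using hz
  have hPm : Monotone P := fun a b hab z hz => (PiNat.cylinder_anti z hab).trans hz
  obtain ⟨L, hL⟩ := hC.subset_of_monotone_cover hPo hPm (fun z hz => by
    obtain ⟨_, ⟨y, n, rfl⟩, hzy, hyO⟩ :=
      (PiNat.isTopologicalBasis_cylinders (fun _ : ℕ => ℤ)).exists_subset_of_mem_open (hCO hz) hO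
    exact mem_iUnion.2 ⟨n, by simpa [P, PiNat.mem_cylinder_iff_eq.1 hzy] using hyO⟩)
  exact ⟨L, fun z hz w hw => hL hz (PiNat.mem_cylinder_iff.2 hw)⟩

/-- Sequences bounded by `N` whose even-indexed terms vanish from the index `2 * N` on. -/
def truncBox (N : ℕ) : Set (ℕ → ℤ) :=
  {c | ∀ i, |c i| ≤ N ∧ ∀ p, N ≤ p → i = 2 * p → c i = 0}

theorem isCompact_truncBox (N : ℕ) : IsCompact (truncBox N) := by
  have : truncBox N = Set.pi univ
      fun i => {z : ℤ | |z| ≤ N ∧ ∀ p, N ≤ p → i = 2 * p → z = 0} := by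
    ext c
    simp [truncBox]
  rw [this]
  refine isCompact_univ_pi fun i => ((finite_Icc (-(N : ℤ)) N).subset ?_).isCompact
  intro z hz
  exact abs_le.1 hz.1

theorem truncBox_mono : Monotone truncBox := by
  intro a b hab c hc i
  have : (a : ℤ) ≤ b := by exact_mod_cast hab
  exact ⟨(hc i).1.trans this, fun p hp => (hc i).2 p (hab.trans hp)⟩

/-- The σ-compact group of bounded sequences with almost all even-indexed terms zero. -/
def evenFinite : AddSubgroup (ℕ → ℤ) where
  carrier := ⋃ N, truncBox N
  zero_mem' := mem_iUnion.2 ⟨0, fun i => by simp⟩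
  add_mem' := by
    intro a b ha hb
    obtain ⟨M, hM⟩ := mem_iUnion.1 ha
    obtain ⟨N, hN⟩ := mem_iUnion.1 hb
    refine mem_iUnion.2 ⟨M + N, fun i => ⟨?_, fun p hp hi => ?_⟩⟩
    · push_cast
      exact (abs_add_le _ _).trans (add_le_add (hM i).1 (hN i).1)
    · simp [(hM i).2 p (by omega) hi, (hN i).2 p (by omega) hi]
  neg_mem' := by
    intro a ha
    obtain ⟨M, hM⟩ := mem_iUnion.1 ha
    refine mem_iUnion.2 ⟨M, fun i => ⟨?_, fun p hp hi => ?_⟩⟩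
    · simpa using (hM i).1
    · simpa using (hM i).2 p hp hi

theorem mem_evenFinite {c : ℕ → ℤ} : c ∈ evenFinite ↔ ∃ N, c ∈ truncBox N := mem_iUnion

open Classical in
/-- The indicator of `s`, transferred to the even indices. -/
noncomputable def evenIndicator (s : Set ℕ) : ℕ → ℤ :=
  fun k => if ∃ p ∈ s, k = 2 * p then 1 else 0

open Classical in
theorem evenIndicator_two_mul (s : Set ℕ) (p : ℕ) :
    evenIndicator s (2 * p) = if p ∈ s then 1 else 0 := by
  simp [evenIndicator]

theorem abs_evenIndicator_le (s : Set ℕ) (k : ℕ) : |evenIndicator s k| ≤ 1 := by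
  unfold evenIndicator
  split_ifs <;> simp

section Hull

variable {ι : Type*}

/-- The integer combination of the even indicators of a family of sets. -/
noncomputable def evenCombo (s : ι → Set ℕ) : (ι →₀ ℤ) →ₗ[ℤ] (ℕ → ℤ) :=
  Finsupp.linearCombination ℤ fun i => evenIndicator (s i)

/-- The group generated by `evenFinite` and the even indicators of a family of sets. -/
noncomputable def evenHull (s : ι → Set ℕ) : AddSubgroup (ℕ → ℤ) :=
  evenFinite ⊔ (LinearMap.range (evenCombo s)).toAddSubgroup

variable {s : ι → Set ℕ}

theorem mem_evenHull {g : ℕ → ℤ} :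
    g ∈ evenHull s ↔ ∃ c ∈ evenFinite, ∃ a, c + evenCombo s a = g := by
  simp [evenHull, AddSubgroup.mem_sup]

theorem evenCombo_apply (a : ι →₀ ℤ) (k : ℕ) :
    evenCombo s a k = ∑ i ∈ a.support, a i * evenIndicator (s i) k := by
  simp [evenCombo, Finsupp.linearCombination_apply, Finsupp.sum]

theorem abs_evenCombo_le (a : ι →₀ ℤ) (k : ℕ) :
    |evenCombo s a k| ≤ ((∑ i ∈ a.support, (a i).natAbs : ℕ) : ℤ) := by
  rw [evenCombo_apply]
  push_cast
  refine (Finset.abs_sum_le_sum_abs _ _).trans (Finset.sum_le_sum fun i _ => ?_)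
  rw [abs_mul]
  exact mul_le_of_le_one_right (abs_nonneg _) (abs_evenIndicator_le _ _)

theorem exists_bound_of_mem_evenHull {g : ℕ → ℤ} (hg : g ∈ evenHull s) :
    ∃ N : ℕ, ∀ k, |g k| ≤ N := by
  obtain ⟨c, hc, a, rfl⟩ := mem_evenHull.1 hg
  obtain ⟨N, hN⟩ := mem_evenFinite.1 hc
  refine ⟨N + ∑ i ∈ a.support, (a i).natAbs, fun k => ?_⟩
  rw [Nat.cast_add]
  exact (abs_add_le _ _).trans (add_le_add (hN k).1 (abs_evenCombo_le a k))

theorem evenFinite_le_evenHull : evenFinite ≤ evenHull s := le_sup_left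

end Hull

/-- Neighbourhoods of zero in a subgroup of the Baer–Specker group contain the elements with a
sufficiently long zero initial segment. -/
theorem exists_zero_segment_subset {G : AddSubgroup (ℕ → ℤ)} {U : Set G} (hU : U ∈ 𝓝 (0 : G)) :
    ∃ L, ∀ g : G, (∀ i < L, (g : ℕ → ℤ) i = 0) → g ∈ U := by
  rw [nhds_subtype, mem_comap] at hU
  obtain ⟨V, hV, hVU⟩ := hU
  obtain ⟨O, hOV, hO, h0⟩ := mem_nhds_iff.1 hV
  obtain ⟨L, hL⟩ := (isCompact_singleton (x := (0 : ℕ → ℤ))).exists_agree_subset hO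
    (by simpa using h0)
  exact ⟨L, fun g hg => hVU (hOV (hL 0 rfl g hg))⟩

theorem HurewiczBounded.of_forall_bounded {G : AddSubgroup (ℕ → ℤ)}
    (hG : ∀ g ∈ G, ∃ N : ℕ, ∀ k, |g k| ≤ N) : HurewiczBounded G := by
  classical
  intro U hU
  choose L hL using fun n => exists_zero_segment_subset (hU n)
  have hF : ∀ n : ℕ, ∃ F : Finset G, ∀ g : G, (∀ k, |(g : ℕ → ℤ) k| ≤ n) →
      ∃ h ∈ F, ∀ i < L n, (g : ℕ → ℤ) i = (h : ℕ → ℤ) i := by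
    intro n
    let r : G → Fin (L n) → ℤ := fun g i => (g : ℕ → ℤ) i
    have hfin : (r '' {g : G | ∀ k, |(g : ℕ → ℤ) k| ≤ n}).Finite := by
      refine (Set.Finite.pi' fun _ : Fin (L n) => finite_Icc (-(n : ℤ)) n).subset ?_
      rintro _ ⟨g, hg, rfl⟩ i
      exact abs_le.1 (hg i)
    have hpre : ∀ y ∈ r '' {g : G | ∀ k, |(g : ℕ → ℤ) k| ≤ n}, ∃ g, r g = y :=
      fun y ⟨g, _, hg⟩ => ⟨g, hg⟩
    choose! q hq using hpre
    refine ⟨hfin.toFinset.image q, fun g hg => ?_⟩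
    have hg' := mem_image_of_mem r (show g ∈ {g : G | ∀ k, |(g : ℕ → ℤ) k| ≤ n} from hg)
    exact ⟨q (r g), Finset.mem_image_of_mem q (hfin.mem_toFinset.2 hg'),
      fun i hi => (congrFun (hq _ hg') ⟨i, hi⟩).symm⟩
  choose F hF using hF
  refine ⟨F, fun g => ?_⟩
  obtain ⟨N, hN⟩ := hG g g.2
  filter_upwards [eventually_ge_atTop N] with n hn
  obtain ⟨h, hhF, hh⟩ := hF n g fun k => (hN k).trans (by exact_mod_cast hn)
  refine Set.mem_add.2 ⟨h, hhF, g - h, hL n _ fun i hi => ?_, by abel⟩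
  simp [hh i hi]

theorem not_rothbergerBounded_of_evenFinite_le {G : AddSubgroup (ℕ → ℤ)} (hG : evenFinite ≤ G) :
    ¬ RothbergerBounded G := by
  intro h
  obtain ⟨a, ha⟩ := h (fun n => {g | (g : ℕ → ℤ) (2 * n + 1) = 0}) (fun n => by
    have hc : Continuous fun g : G => (g : ℕ → ℤ) (2 * n + 1) :=
      (continuous_apply _).comp continuous_subtype_val
    exact ((isOpen_discrete {(0 : ℤ)}).preimage hc).mem_nhds (by simp))
  let c : ℕ → ℤ := fun k =>
    if k % 2 = 1 then (if (a (k / 2) : ℕ → ℤ) k = 0 then 1 else 0) else 0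
  have hc : c ∈ evenFinite := by
    refine mem_evenFinite.2 ⟨1, fun i => ⟨?_, fun p _ hi => ?_⟩⟩
    · simp only [c]
      split_ifs <;> simp
    · simp [c, hi]
  obtain ⟨n, hn⟩ := ha ⟨c, hG hc⟩
  obtain ⟨_, rfl, u, hu, hsum⟩ := Set.mem_add.1 hn
  have hsum' := congrArg (fun g : G => (g : ℕ → ℤ) (2 * n + 1)) hsum
  have hdiv : (2 * n + 1) / 2 = n := by omega
  have hmod : (2 * n + 1) % 2 = 1 := by omega
  rw [mem_ofPred_eq] at hu
  simp only [AddSubgroup.coe_add, Pi.add_apply, hu, c, hdiv, hmod, add_zero, if_true] at hsum'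
  split_ifs at hsum' with h0
  · omega
  · exact h0 hsum'

section Covering

variable {ι : Type*} {s : ι → Set ℕ}

open Classical in
/-- If no element of the hull is eventually one along the even indices, and the enumerations of the
complements of the sets `s i` are unbounded, then the hull is not Hurewicz. -/
theorem not_hasHurewicz_evenHull
    (hinf : ∀ a, ∃ᶠ p in atTop, evenCombo s a (2 * p) ≠ 1)
    (hunb : ∀ f : ℕ → ℕ, ∃ i, ∃ᶠ n in atTop, {p ∈ Finset.range (f n) | p ∉ s i}.card ≤ n) :
    ¬ HasHurewicz (evenHull s) := by
  intro h
  let D : ℕ → evenHull s → Finset ℕ :=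
    fun m g => {p ∈ Finset.range m | (g : ℕ → ℤ) (2 * p) ≠ 1}
  have hDm : ∀ g, Monotone fun m => D m g := fun g a b hab =>
    Finset.filter_subset_filter _ (Finset.range_mono hab)
  obtain ⟨f, hf⟩ := h.exists_bound (fun n m => {g | n < (D m g).card}) (fun n m => by
      have hset : {g : evenHull s | n < (D m g).card} =
          ⋃ T ∈ {T : Finset ℕ | n < T.card ∧ T ⊆ Finset.range m},
            ⋂ p ∈ T, {g : evenHull s | (g : ℕ → ℤ) (2 * p) ≠ 1} := by
        ext g
        simp only [mem_ofPred_eq, mem_iUnion, mem_iInter, exists_prop]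
        constructor
        · exact fun hg => ⟨D m g, ⟨hg, Finset.filter_subset _ _⟩,
            fun p hp => (Finset.mem_filter.1 hp).2⟩
        · rintro ⟨T, ⟨hT, hTm⟩, hTg⟩
          exact hT.trans_le (Finset.card_le_card fun p hp =>
            Finset.mem_filter.2 ⟨hTm hp, hTg p hp⟩)
      rw [hset]
      refine isOpen_biUnion fun T _ => isOpen_biInter_finset fun p _ => ?_
      have hc : Continuous fun g : evenHull s => (g : ℕ → ℤ) (2 * p) :=
        (continuous_apply _).comp continuous_subtype_val
      exact (isOpen_discrete {(1 : ℤ)}ᶜ).preimage hc)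
    (fun n a b hab g hg => lt_of_lt_of_le hg (Finset.card_le_card (hDm g hab)))
    (fun n => eq_univ_of_forall fun g => by
      obtain ⟨c, hc, a, hca⟩ := mem_evenHull.1 g.2
      obtain ⟨N, hN⟩ := mem_evenFinite.1 hc
      have hfr : ∃ᶠ p in atTop, (g : ℕ → ℤ) (2 * p) ≠ 1 := by
        refine ((hinf a).and_eventually (eventually_ge_atTop N)).mono fun p hp => ?_
        rw [← hca, Pi.add_apply, (hN (2 * p)).2 p hp.2 rfl, zero_add]
        exact hp.1
      obtain ⟨T, hT, hTc⟩ := (Nat.frequently_atTop_iff_infinite.1 hfr).exists_subset_card_eq (n + 1)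
      refine mem_iUnion.2 ⟨T.sup id + 1, ?_⟩
      have : T ⊆ D (T.sup id + 1) g := fun p hp => Finset.mem_filter.2
        ⟨Finset.mem_range.2 (Nat.lt_succ_of_le (Finset.le_sup (f := id) hp)), hT hp⟩
      have := Finset.card_le_card this
      show n < _
      omega)
  obtain ⟨i, hi⟩ := hunb f
  have hmem : evenIndicator (s i) ∈ evenHull s :=
    mem_evenHull.2 ⟨0, zero_mem _, Finsupp.single i 1, by simp [evenCombo]⟩
  obtain ⟨n, hn, hn'⟩ := (hi.and_eventually (hf ⟨_, hmem⟩)).exists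
  have : D (f n) ⟨_, hmem⟩ = {p ∈ Finset.range (f n) | p ∉ s i} := by
    refine Finset.filter_congr fun p _ => ?_
    simp [evenIndicator_two_mul]
  rw [mem_ofPred_eq, this] at hn'
  omega

theorem exists_translate_truncBox_subset {W : ℕ → ℕ → Set (ℕ → ℤ)}
    (hWo : ∀ n m, IsOpen (W n m)) (hWm : ∀ n, Monotone (W n))
    (hWc : ∀ n, (evenHull s : Set (ℕ → ℤ)) ⊆ ⋃ m, W n m) {y : ℕ → ℤ} (hy : y ∈ evenHull s)
    (n : ℕ) : ∃ m, ∀ c ∈ truncBox n, y + c ∈ W n m := by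
  obtain ⟨m, hm⟩ := ((isCompact_truncBox n).image (continuous_const_add y)).subset_of_monotone_cover
    (hWo n) (hWm n) (by
      rintro _ ⟨c, hc, rfl⟩
      exact hWc n (add_mem hy (evenFinite_le_evenHull (mem_evenFinite.2 ⟨n, hc⟩))))
  exact ⟨m, fun c hc => hm (mem_image_of_mem _ hc)⟩

/-- The hull of a family too small to be dominating is Menger. -/
theorem hasMenger_evenHull_of_not_dominating
    (hι : ∀ φ : (ι →₀ ℤ) → ℕ → ℕ, ∃ f : ℕ → ℕ, ∀ a, ∃ᶠ n in atTop, φ a n ≤ f n) :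
    HasMenger (evenHull s) := by
  refine HasMenger.of_monotone_covers (G := (evenHull s : Set (ℕ → ℤ))) ⟨0, zero_mem _⟩ ?_
  intro W hWo hWm hWc
  have hmem : ∀ a, evenCombo s a ∈ evenHull s :=
    fun a => mem_evenHull.2 ⟨0, zero_mem _, a, zero_add _⟩
  choose φ hφ using fun a => exists_translate_truncBox_subset hWo hWm hWc (hmem a)
  obtain ⟨f, hf⟩ := hι φ
  refine ⟨f, fun g hg => ?_⟩
  obtain ⟨c, hc, a, rfl⟩ := mem_evenHull.1 hg
  obtain ⟨N, hN⟩ := mem_evenFinite.1 hc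
  obtain ⟨n, hn, hNn⟩ := ((hf a).and_eventually (eventually_ge_atTop N)).exists
  refine ⟨n, hWm n hn ?_⟩
  rw [add_comm]
  exact hφ a n c (truncBox_mono hNn hN)

/-- `U`-many members of the array `W`, evaluated along a single function, contain any given point
of `Z`. -/
def UltraCovered {Y : Type*} (U : Ultrafilter ℕ) (W : ℕ → ℕ → Set Y) (Z : Set Y) : Prop :=
  ∃ f : ℕ → ℕ, ∀ z ∈ Z, ∀ᶠ n in U, z ∈ W n (f n)

theorem UltraCovered.mono {Y : Type*} {U : Ultrafilter ℕ} {W : ℕ → ℕ → Set Y} {Z Z' : Set Y}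
    (h : UltraCovered U W Z) (hZ : Z' ⊆ Z) : UltraCovered U W Z' :=
  h.imp fun _ hf z hz => hf z (hZ hz)

theorem UltraCovered.union {Y : Type*} {U : Ultrafilter ℕ} {W : ℕ → ℕ → Set Y}
    (hWm : ∀ n, Monotone (W n)) {Z Z' : Set Y} (h : UltraCovered U W Z)
    (h' : UltraCovered U W Z') : UltraCovered U W (Z ∪ Z') := by
  obtain ⟨f, hf⟩ := h
  obtain ⟨f', hf'⟩ := h'
  refine ⟨f ⊔ f', fun z hz => ?_⟩
  rcases hz with hz | hz
  · exact (hf z hz).mono fun n hn => hWm n le_sup_left hn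
  · exact (hf' z hz).mono fun n hn => hWm n le_sup_right hn

theorem UltraCovered.iUnion {Y κ : Type*} {U : Ultrafilter ℕ} (hU : (U : Filter ℕ) ≤ atTop)
    {W : ℕ → ℕ → Set Y} (hWm : ∀ n, Monotone (W n)) (hκ : FamilyBounded κ) {Z : κ → Set Y}
    (h : ∀ j, UltraCovered U W (Z j)) : UltraCovered U W (⋃ j, Z j) := by
  choose φ hφ using h
  obtain ⟨f, hf⟩ := hκ φ
  refine ⟨f, fun z hz => ?_⟩
  obtain ⟨j, hj⟩ := mem_iUnion.1 hz
  filter_upwards [hφ j z hj, (hf j).filter_mono hU] with n hn hle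
  exact hWm n hle hn

/-- The hull of a family concentrated on `evenFinite` modulo an ultrafilter is Menger. -/
theorem hasMenger_evenHull_of_concentrated {U : Ultrafilter ℕ} (hU : (U : Filter ℕ) ≤ atTop)
    (hs : ∀ b : ℕ → ℕ, FamilyBounded {i // ¬ ∀ᶠ p in U, ∀ q, p ≤ q → q < b p → q ∉ s i}) :
    HasMenger (evenHull s) := by
  classical
  refine HasMenger.of_monotone_covers (G := (evenHull s : Set (ℕ → ℤ))) ⟨0, zero_mem _⟩ ?_
  intro W hWo hWm hWc
  let Z : (ℕ → ℤ) → ℕ → Set (ℕ → ℤ) := fun y k =>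
    {x | ∃ c ∈ evenFinite, ∃ a : ι →₀ ℤ, a.support.card ≤ k ∧ x = y + (c + evenCombo s a)}
  have hbase : ∀ y ∈ evenHull s, ∃ b : ℕ → ℕ, UltraCovered U W
      {x | ∃ c ∈ evenFinite, ∃ a : ι →₀ ℤ,
        (∀ i ∈ a.support, ∀ᶠ p in U, ∀ q, p ≤ q → q < b p → q ∉ s i) ∧
          x = y + (c + evenCombo s a)} := by
    intro y hy
    choose f hf using exists_translate_truncBox_subset hWo hWm hWc hy
    choose b hb using fun n => (isCompact_truncBox n).exists_agree_subset
      ((hWo n (f n)).preimage (continuous_const_add y)) (hf n)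
    refine ⟨b, f, ?_⟩
    rintro _ ⟨c, hc, a, ha, rfl⟩
    obtain ⟨N, hN⟩ := mem_evenFinite.1 hc
    filter_upwards [(Finset.eventually_all a.support).2 ha,
      hU (eventually_ge_atTop (N + ∑ i ∈ a.support, (a i).natAbs))] with n hn hNn
    have hNn : N + ∑ i ∈ a.support, (a i).natAbs ≤ n := hNn
    let v := c + evenCombo s a
    have hv : ∀ k, |v k| ≤ n := fun k => by
      have : ((N + ∑ i ∈ a.support, (a i).natAbs : ℕ) : ℤ) ≤ n := by exact_mod_cast hNn
      refine le_trans ?_ this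
      rw [Nat.cast_add]
      exact (abs_add_le _ _).trans (add_le_add (hN k).1 (abs_evenCombo_le a k))
    let v' : ℕ → ℤ := fun k => if ∃ p, n ≤ p ∧ k = 2 * p then 0 else v k
    refine hb n v' (fun k => ⟨?_, fun p hp hk => if_pos ⟨p, hp, hk⟩⟩) v fun k hk => ?_
    · simp only [v']
      split_ifs
      · simp
      · exact hv k
    · simp only [v']
      split_ifs with hp
      · obtain ⟨p, hp, rfl⟩ := hp
        simp only [v, Pi.add_apply, (hN (2 * p)).2 p (by omega) rfl, zero_add, evenCombo_apply]
        refine Finset.sum_eq_zero fun i hi => ?_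
        rw [evenIndicator_two_mul, if_neg (hn i hi p hp (by omega)), mul_zero]
      · rfl
  have hZ : ∀ k, ∀ y ∈ evenHull s, UltraCovered U W (Z y k) := by
    intro k
    induction k with
    | zero =>
      intro y hy
      obtain ⟨b, hb⟩ := hbase y hy
      refine hb.mono ?_
      rintro _ ⟨c, hc, a, ha, rfl⟩
      have : a.support = ∅ := Finset.card_eq_zero.1 (Nat.le_zero.1 ha)
      exact ⟨c, hc, a, by simp [this], rfl⟩
    | succ k ih =>
      intro y hy
      obtain ⟨b, hb⟩ := hbase y hy
      have hgen : ∀ i, evenIndicator (s i) ∈ evenHull s := fun i =>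
        mem_evenHull.2 ⟨0, zero_mem _, Finsupp.single i 1, by simp [evenCombo]⟩
      have hrest := UltraCovered.iUnion hU hWm (hs b) fun i =>
        UltraCovered.iUnion hU hWm (FamilyBounded.of_countable ℤ) fun m =>
          ih (y + m • evenIndicator (s i)) (add_mem hy (zsmul_mem (hgen i) m))
      refine (hb.union hWm hrest).mono ?_
      rintro _ ⟨c, hc, a, ha, rfl⟩
      by_cases hall : ∀ i ∈ a.support, ∀ᶠ p in U, ∀ q, p ≤ q → q < b p → q ∉ s i
      · exact Or.inl ⟨c, hc, a, hall, rfl⟩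
      · obtain ⟨i, hi, hbad⟩ : ∃ i ∈ a.support,
            ¬ ∀ᶠ p in U, ∀ q, p ≤ q → q < b p → q ∉ s i := by
          simpa only [not_forall, exists_prop] using hall
        refine Or.inr (mem_iUnion₂.2 ⟨⟨i, hbad⟩, a i, c, hc, a.erase i, ?_, ?_⟩)
        · rw [Finsupp.support_erase, Finset.card_erase_of_mem hi]
          omega
        · conv_lhs => rw [← Finsupp.single_add_erase i a]
          simp only [map_add, evenCombo, Finsupp.linearCombination_single]
          abel
  obtain ⟨f, hf⟩ := UltraCovered.iUnion hU hWm (FamilyBounded.of_countable ℕ)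
    fun k => hZ k 0 (zero_mem _)
  refine ⟨f, fun g hg => ?_⟩
  obtain ⟨c, hc, a, rfl⟩ := mem_evenHull.1 hg
  exact (hf _ (mem_iUnion.2 ⟨_, c, hc, a, le_rfl, (zero_add _).symm⟩)).exists

end Covering

/-- Some set of naturals misses `U`-many of the intervals `[p, b p)` and contains infinitely many of
them. -/
theorem exists_sparse_set_containing_intervals (U : Ultrafilter ℕ) {b : ℕ → ℕ} (hb : Monotone b)
    (hlt : ∀ n, n < b n) :
    ∃ s : Set ℕ, (∀ᶠ p in U, ∀ q, p ≤ q → q < b p → q ∉ s) ∧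
      ∃ᶠ n in atTop, ∀ q, n ≤ q → q < b n → q ∈ s := by
  let h : ℕ → ℕ := fun j => b^[j] 0
  have hsucc : ∀ j, h (j + 1) = b (h j) := fun j => Function.iterate_succ_apply' b j 0
  have hmono : StrictMono h := strictMono_nat_of_lt_succ fun j => by
    rw [hsucc]
    exact hlt _
  have hex : ∀ p, ∃ j, h j ≤ p ∧ p < h (j + 1) := by
    intro p
    have h0 : h 0 ≤ p := Nat.zero_le p
    refine ⟨Nat.findGreatest (fun j => h j ≤ p) p,
      Nat.findGreatest_spec (P := fun j => h j ≤ p) (Nat.zero_le p) h0, ?_⟩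
    by_contra hcon
    have hle := not_lt.1 hcon
    have := Nat.le_findGreatest (P := fun j => h j ≤ p) ((hmono.id_le _).trans hle) hle
    exact (Nat.lt_succ_self _).not_ge this
  choose τ hτ hτ' using hex
  have huniq : ∀ j q, h j ≤ q → q < h (j + 1) → τ q = j := by
    intro j q h1 h2
    have h3 := hmono.lt_iff_lt.1 ((hτ q).trans_lt h2)
    have h4 := hmono.lt_iff_lt.1 (h1.trans_lt (hτ' q))
    omega
  obtain ⟨r, hr⟩ : ∃ r, ∀ᶠ p in U, τ p % 3 = r := by
    have : ∀ᶠ p in U, τ p % 3 = 0 ∨ τ p % 3 = 1 ∨ τ p % 3 = 2 := .of_forall fun p => by omega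
    rw [Ultrafilter.eventually_or, Ultrafilter.eventually_or] at this
    rcases this with h | h | h
    exacts [⟨_, h⟩, ⟨_, h⟩, ⟨_, h⟩]
  refine ⟨{q | τ q % 3 = (r + 2) % 3}, hr.mono fun p hp q hpq hqb hq => ?_, ?_⟩
  · have hq : τ q % 3 = (r + 2) % 3 := hq
    have h1 : q < h (τ p + 2) :=
      hqb.trans_le ((hb (hτ' p).le).trans (hsucc _).ge)
    have h2 := hmono.lt_iff_lt.1 ((hτ q).trans_lt h1)
    have h3 := hmono.lt_iff_lt.1 (((hτ p).trans hpq).trans_lt (hτ' q))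
    omega
  · refine frequently_atTop.2 fun N => ⟨h (3 * N + r + 2), ?_, fun q h1 h2 => ?_⟩
    · have := hmono.id_le (3 * N + r + 2)
      simp only [id] at this
      omega
    · show τ q % 3 = _
      rw [huniq _ q h1 (h2.trans_le (hsucc _).ge)]
      omega

/-- The complement of the graph of a function, coded by the pairing function. -/
def cograph (b : ℕ → ℕ) : Set ℕ := {p | p.unpair.2 ≠ b p.unpair.1}

theorem pair_mem_cograph {b : ℕ → ℕ} {n k : ℕ} : Nat.pair n k ∈ cograph b ↔ k ≠ b n := by
  simp [cograph]

theorem frequently_evenCombo_cograph_ne_one {ι : Type*} (b : ι → ℕ → ℕ) (a : ι →₀ ℤ) :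
    ∃ᶠ p in atTop, evenCombo (fun i => cograph (b i)) a (2 * p) ≠ 1 := by
  intro hcon
  obtain ⟨P, hP⟩ := eventually_atTop.1 hcon
  let M : ℤ := ∑ i ∈ a.support, a i
  let L₀ := a.support.sup fun i => b i P
  have key : ∀ L, L₀ < L → M * (L - 1) = L := by
    intro L hL
    have hrow : ∀ k ∈ Finset.range L,
        ∑ i ∈ a.support, a i * (if k ≠ b i P then 1 else 0) = (1 : ℤ) := by
      intro k _
      have := not_not.1 (hP (Nat.pair P k) (Nat.left_le_pair P k))
      rw [evenCombo_apply] at this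
      simpa only [evenIndicator_two_mul, pair_mem_cograph] using this
    have hsum := Finset.sum_congr rfl hrow
    rw [Finset.sum_comm] at hsum
    have hcol : ∀ i ∈ a.support,
        ∑ k ∈ Finset.range L, a i * (if k ≠ b i P then 1 else 0) = a i * (L - 1 : ℤ) := by
      intro i hi
      have hlt : b i P < L := (Finset.le_sup (f := fun i => b i P) hi).trans_lt hL
      have : ∀ k, (if k ≠ b i P then 1 else 0 : ℤ) = 1 - if k = b i P then 1 else 0 := by
        intro k
        split_ifs <;> simp_all
      simp [← Finset.mul_sum, this, Finset.sum_sub_distrib, hlt]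
    rw [Finset.sum_congr rfl hcol, ← Finset.sum_mul] at hsum
    simpa using hsum
  have h1 := key (L₀ + 1) (by omega)
  have h2 := key (L₀ + 2) (by omega)
  have h3 := key (L₀ + 3) (by omega)
  push_cast at h1 h2 h3
  have hM : M = 1 := by linarith
  rw [hM] at h1
  linarith

open Classical in
theorem exists_card_compl_cograph_le {B : Type*} {φ : B → ℕ → ℕ}
    (hφ : ∀ f : ℕ → ℕ, ∃ i, ¬ ∀ᶠ n in atTop, φ i n ≤ f n) (hmono : ∀ i, StrictMono (φ i))
    (f : ℕ → ℕ) :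
    ∃ i, ∃ᶠ n in atTop, {p ∈ Finset.range (f n) | p ∉ cograph (φ i)}.card ≤ n := by
  obtain ⟨i, hi⟩ := hφ f
  refine ⟨i, (not_eventually.1 hi).mono fun n hn => ?_⟩
  calc _ ≤ ((Finset.range n).image fun j => Nat.pair j (φ i j)).card := by
        refine Finset.card_le_card fun p hp => ?_
        obtain ⟨hpf, hp⟩ := Finset.mem_filter.1 hp
        have heq : p.unpair.2 = φ i p.unpair.1 := not_not.1 hp
        refine Finset.mem_image.2 ⟨p.unpair.1, Finset.mem_range.2 ?_, ?_⟩
        · by_contra hcon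
          have h1 := (hmono i).monotone (not_lt.1 hcon)
          have h2 := Nat.unpair_right_le p
          have h3 := Finset.mem_range.1 hpf
          omega
        · rw [← heq, Nat.pair_unpair]
    _ ≤ n := Finset.card_image_le.trans (Finset.card_range n).le

/-- Let `B` index an unbounded family of least cardinality. Either no family indexed by `B →₀ ℤ` is
dominating, and cographs generate a hull with the required properties, or there is a scale, and a
family of sets concentrated on it does. -/
theorem exists_evenHull_menger_not_hurewicz :
    ∃ (ι : Type) (s : ι → Set ℕ), HasMenger (evenHull s) ∧ ¬ HasHurewicz (evenHull s) := by
  classical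
  obtain ⟨B, hB, hmin⟩ := exists_minimal_unbounded
  by_cases hdom : ∀ φ : (B →₀ ℤ) → ℕ → ℕ, ∃ f : ℕ → ℕ, ∀ a, ∃ᶠ n in atTop, φ a n ≤ f n
  · simp only [FamilyBounded, not_forall, not_exists] at hB
    obtain ⟨φ, hφ⟩ := hB
    let ψ : B → ℕ → ℕ := fun i n => ∑ j ∈ Finset.range (n + 1), (φ i j + 1)
    have hψ : ∀ i n, φ i n ≤ ψ i n := fun i n => by
      simp only [ψ, Finset.sum_range_succ]
      omega
    refine ⟨B, fun i => cograph (ψ i), hasMenger_evenHull_of_not_dominating hdom,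
      not_hasHurewicz_evenHull (frequently_evenCombo_cograph_ne_one ψ)
        (exists_card_compl_cograph_le (fun f => ?_) fun i => strictMono_nat_of_lt_succ fun n => ?_)⟩
    · obtain ⟨i, hi⟩ := hφ f
      exact ⟨i, fun h => hi (h.mono fun n hn => (hψ i n).trans hn)⟩
    · simp only [ψ, Finset.sum_range_succ _ (n + 1)]
      omega
  · push Not at hdom
    obtain ⟨φ, hφ⟩ := hdom
    have : Infinite B := by
      by_contra h
      have := not_infinite_iff_finite.1 h
      exact hB (FamilyBounded.of_countable B)
    have hcard : Cardinal.mk (B →₀ ℤ) = Cardinal.mk B := by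
      rw [Cardinal.mk_finsupp_of_infinite, Cardinal.mk_int, max_eq_left (Cardinal.aleph0_le_mk B)]
    let ι := (Cardinal.mk B).ord.ToType
    have hιcard : Cardinal.mk ι = Cardinal.mk (B →₀ ℤ) := by simp [ι, hcard]
    obtain ⟨e⟩ := Cardinal.eq.1 hιcard
    have hseg : ∀ i : ι, FamilyBounded (Iio i) := fun i =>
      hmin _ ((Cardinal.mk_Iio_lt i (by simp [ι])).trans_eq (by simp [ι]))
    choose g hg using fun i => hseg i fun j => φ (e j)
    let b : ι → ℕ → ℕ := fun i n => ∑ j ∈ Finset.range (n + 1), (g i j + φ (e i) j + 1)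
    have hgb : ∀ i n, g i n + φ (e i) n ≤ b i n := fun i n => by
      simp only [b, Finset.sum_range_succ]
      omega
    have hbm : ∀ i, StrictMono (b i) := fun i => strictMono_nat_of_lt_succ fun n => by
      simp only [b, Finset.sum_range_succ _ (n + 1)]
      omega
    have hblt : ∀ i n, n < b i n := fun i n => by
      induction n with
      | zero => simp [b]
      | succ n ih => exact lt_of_le_of_lt ih (hbm i n.lt_succ_self)
    have hscale : ∀ f : ℕ → ℕ, ∃ j, ∀ i, j ≤ i → ∀ᶠ n in atTop, f n ≤ b i n := by
      intro f
      obtain ⟨x, hx⟩ := hφ f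
      obtain ⟨j, rfl⟩ := e.surjective x
      refine ⟨j, fun i hij => ?_⟩
      rcases hij.eq_or_lt with rfl | hlt
      · filter_upwards [hx] with n hn
        have := hgb j n
        omega
      · filter_upwards [hx, hg i ⟨j, hlt⟩] with n hn hn'
        have := hgb i n
        omega
    let U : Ultrafilter ℕ := hyperfilter ℕ
    have hU : (U : Filter ℕ) ≤ atTop := Nat.hyperfilter_le_atTop
    choose s hsU hsI using fun i =>
      exists_sparse_set_containing_intervals U (hbm i).monotone (hblt i)
    refine ⟨ι, s, hasMenger_evenHull_of_concentrated hU fun f => ?_,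
      not_hasHurewicz_evenHull (fun a => ?_) fun f => ?_⟩
    · obtain ⟨j, hj⟩ := hscale f
      have hlt : ∀ i, (¬ ∀ᶠ p in U, ∀ q, p ≤ q → q < f p → q ∉ s i) → i < j := by
        intro i hi
        by_contra hcon
        refine hi ?_
        filter_upwards [hsU i, (hj i (not_lt.1 hcon)).filter_mono hU] with p hp hfb q h1 h2
        exact hp q h1 (h2.trans_le hfb)
      exact (hseg j).of_injective (e := fun i => ⟨i.1, hlt i.1 i.2⟩)
        fun x y hxy => Subtype.ext (congrArg (fun z : Iio j => z.1) hxy)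
    · have : ∀ᶠ p in U, evenCombo s a (2 * p) ≠ 1 := by
        filter_upwards [(Finset.eventually_all a.support).2 fun i _ => hsU i] with p hp
        rw [evenCombo_apply, Finset.sum_eq_zero fun i hi => ?_]
        · exact zero_ne_one
        · rw [evenIndicator_two_mul, if_neg (hp i hi p le_rfl (hblt i p)), mul_zero]
      exact this.frequently.filter_mono hU
    · obtain ⟨i, hi⟩ := hscale f
      refine ⟨i, ((hsI i).and_eventually (hi i le_rfl)).mono fun n hn => ?_⟩
      calc _ ≤ (Finset.range n).card := by
            refine Finset.card_le_card fun p hp => ?_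
            obtain ⟨hpf, hp⟩ := Finset.mem_filter.1 hp
            rw [Finset.mem_range] at hpf ⊢
            by_contra hcon
            exact hp (hn.1 p (not_lt.1 hcon) (hpf.trans_le hn.2))
        _ = n := Finset.card_range n

theorem stmt_18 :
    ∃ G : AddSubgroup (ℕ → ℤ), HurewiczBounded ↥G ∧ HasMenger ↥G ∧
      ¬ HasHurewicz ↥G ∧ ¬ RothbergerBounded ↥G := by
  obtain ⟨ι, s, hM, hH⟩ := exists_evenHull_menger_not_hurewicz
  exact ⟨evenHull s, HurewiczBounded.of_forall_bounded fun _ hg => exists_bound_of_mem_evenHull hg,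
    hM, hH, not_rothbergerBounded_of_evenFinite_le evenFinite_le_evenHull⟩
end

section
/- There is no subgroup G of the Baer–Specker group ℤ^ℕ such that G has the Hurewicz property and G is Rothberger-bounded, but G does not have the Rothberger property. Equivalently, every subgroup of ℤ^ℕ that has the Hurewicz property and is Rothberger-bounded has the Rothberger property. -/
open Filter Set Topology Pointwise

/-- Near each point, all sufficiently small translates meeting a fixed neighbourhood of that point
lie in a single member of an open cover. -/
lemma exists_translate_subset_of_openCover {G : Type*} [AddGroup G] [TopologicalSpace G]
    [IsTopologicalAddGroup G] {B : ℕ → Set G} (hB : (nhds (0 : G)).HasAntitoneBasis B)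
    {𝒰 : Set (Set G)} (ho : ∀ u ∈ 𝒰, IsOpen u) (hc : ⋃₀ 𝒰 = univ) (g : G) :
    ∃ W, IsOpen W ∧ g ∈ W ∧ ∃ r, ∀ x ∈ W, ∃ u ∈ 𝒰, ∀ a, x ∈ {a} + B r → {a} + B r ⊆ u := by
  obtain ⟨u, hu, hgu⟩ : g ∈ ⋃₀ 𝒰 := hc ▸ mem_univ g
  have hcont : Continuous fun p : G × G × G ↦ p.1 - p.2.1 + p.2.2 := by fun_prop
  have hmem : (fun p : G × G × G ↦ p.1 - p.2.1 + p.2.2) ⁻¹' u ∈ nhds (g, (0 : G), (0 : G)) :=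
    hcont.continuousAt.preimage_mem_nhds ((ho u hu).mem_nhds (by simpa using hgu))
  rw [nhds_prod_eq, nhds_prod_eq, mem_prod_iff] at hmem
  obtain ⟨W, hW, T, hT, hWT⟩ := hmem
  obtain ⟨r, -, hr⟩ := (hB.toHasBasis.prod_self).mem_iff.1 hT
  obtain ⟨W', hW'W, hW'o, hgW'⟩ := mem_nhds_iff.1 hW
  refine ⟨W', hW'o, hgW', r, fun x hx ↦ ⟨u, hu, fun a hxa ↦ ?_⟩⟩
  rw [singleton_add] at hxa ⊢
  obtain ⟨b, hb, rfl⟩ := hxa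
  rintro _ ⟨c, hc, rfl⟩
  have := hWT (mk_mem_prod (hW'W hx) (hr (mk_mem_prod hb hc)))
  simpa using this

/-- A first-countable topological group with the Hurewicz property that is Rothberger-bounded has
the Rothberger property. -/
theorem HasHurewicz.hasRothberger {G : Type*} [AddGroup G] [TopologicalSpace G]
    [IsTopologicalAddGroup G] [FirstCountableTopology G] (hH : HasHurewicz G)
    (hR : RothbergerBounded G) : HasRothberger G := by
  intro 𝒰 ho hc
  obtain ⟨B, hB⟩ := (nhds (0 : G)).exists_antitone_basis
  let P : ℕ → ℕ → G → Prop := fun n r x ↦ ∃ u ∈ 𝒰 n, ∀ a, x ∈ {a} + B r → {a} + B r ⊆ u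
  have hP : ∀ n x r s, r ≤ s → P n r x → P n s x := by
    rintro n x r s hrs ⟨u, hu, h⟩
    have hsub : ∀ a : G, {a} + B s ⊆ {a} + B r := fun a ↦ add_subset_add_left (hB.antitone hrs)
    exact ⟨u, hu, fun a hx ↦ (hsub a).trans (h a (hsub a hx))⟩
  obtain ⟨F, hF, hFx⟩ := hH (fun n ↦ {W | IsOpen W ∧ ∃ r, ∀ x ∈ W, P n r x})
    (fun n W hW ↦ hW.1) fun n ↦ eq_univ_of_forall fun g ↦ by
      obtain ⟨W, hW, hg, hr⟩ := exists_translate_subset_of_openCover hB (ho n) (hc n) g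
      exact ⟨W, ⟨hW, hr⟩, hg⟩
  have hbound : ∀ n, ∃ r, ∀ x ∈ ⋃₀ F n, P n r x := by
    intro n
    choose! ρ hρ using fun W (hW : W ∈ F n) ↦ ((hF n).2 hW).2
    obtain ⟨r, hr⟩ := ((hF n).1.image ρ).bddAbove
    refine ⟨r, ?_⟩
    rintro x ⟨W, hW, hx⟩
    exact hP n x _ _ (hr (mem_image_of_mem ρ hW)) (hρ W hW x hx)
  choose f hf using hbound
  choose a ha using fun m ↦ hR (fun k ↦ B (f (Nat.pair m k))) fun k ↦ hB.mem _
  have hu : ∀ n, ∃ u ∈ 𝒰 n, (∃ v ∈ 𝒰 n, {a n.unpair.1 n.unpair.2} + B (f n) ⊆ v) →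
      {a n.unpair.1 n.unpair.2} + B (f n) ⊆ u := by
    intro n
    by_cases h : ∃ v ∈ 𝒰 n, {a n.unpair.1 n.unpair.2} + B (f n) ⊆ v
    · obtain ⟨v, hv, hsub⟩ := h
      exact ⟨v, hv, fun _ ↦ hsub⟩
    · obtain ⟨v, hv, -⟩ : (0 : G) ∈ ⋃₀ 𝒰 n := hc n ▸ mem_univ _
      exact ⟨v, hv, fun h' ↦ absurd h' h⟩
  choose u hu hsub using hu
  refine ⟨u, hu, eq_univ_of_forall fun g ↦ mem_iUnion.2 ?_⟩
  obtain ⟨m, hm⟩ := eventually_atTop.1 (hFx g)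
  obtain ⟨k, hk⟩ := ha m g
  obtain ⟨v, hv, hva⟩ := hf _ g (hm (Nat.pair m k) (Nat.left_le_pair m k))
  refine ⟨Nat.pair m k, hsub _ ⟨v, hv, ?_⟩ ?_⟩ <;> rw [Nat.unpair_pair]
  exacts [hva _ hk, hk]

theorem stmt_19 :
    (¬ ∃ G : AddSubgroup (ℕ → ℤ),
        HasHurewicz ↥G ∧ RothbergerBounded ↥G ∧ ¬ HasRothberger ↥G) ∧
    (∀ G : AddSubgroup (ℕ → ℤ),
        HasHurewicz ↥G → RothbergerBounded ↥G → HasRothberger ↥G) := by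
  have main : ∀ G : AddSubgroup (ℕ → ℤ),
      HasHurewicz ↥G → RothbergerBounded ↥G → HasRothberger ↥G :=
    fun G hH hR ↦
      have : FirstCountableTopology ↥G := IsInducing.subtypeVal.firstCountableTopology
      hH.hasRothberger hR
  exact ⟨fun ⟨G, hH, hR, hn⟩ ↦ hn (main G hH hR), main⟩
end
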